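/- Let (T,A) be a measurable cocycle with Lyapunov exponents θ₁ ≥ ... ≥ θ_p, and let λ > 0 be smaller than every strictly positive Lyapunov exponent. For almost every x, every line J in ℝ^p not through 0 and parallel to a direction in a compact set Θ adapted to the cocycle satisfies: there exists ε₀ > 0 such that μ{x : ln(‖A_n(x)·J‖/‖J‖) < ε₀ n} → 0 as n → ∞, uniformly over J ∈ J(Θ), where ‖J‖ denotes the distance from the line J to the origin, provided J ∩ E^{cs}(x) = ∅ for almost every x for each such J. -/

import Mathlib

open MeasureTheory Filter Metric
open scoped BigOperators ENNReal

/-- The cocycle iterates `A_n(x) = A(T^{n-1} x) ⋯ A(x)`. -/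
noncomputable def cocycleIter {α : Type*} {p : ℕ} (T : α → α)
    (A : α → (EuclideanSpace ℝ (Fin p) ≃L[ℝ] EuclideanSpace ℝ (Fin p))) :
    ℕ → α → (EuclideanSpace ℝ (Fin p) ≃L[ℝ] EuclideanSpace ℝ (Fin p))
  | 0, _ => ContinuousLinearEquiv.refl ℝ (EuclideanSpace ℝ (Fin p))
  | n + 1, x => (A x).trans (cocycleIter T A n (T x))

/-- The central stable space `E^{cs}(x) = {w : limsup ‖A_n(x)·w‖^{1/n} ≤ 1}`. -/
noncomputable def centralStable {α : Type*} {p : ℕ} (T : α → α)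
    (A : α → (EuclideanSpace ℝ (Fin p) ≃L[ℝ] EuclideanSpace ℝ (Fin p))) (x : α) :
    Set (EuclideanSpace ℝ (Fin p)) :=
  {w | limsup (fun n : ℕ => ‖cocycleIter T A n x w‖ ^ ((1 : ℝ) / n)) atTop ≤ 1}

/-- The affine line through `u` with direction `v`. -/
def lineDir {p : ℕ} (v u : EuclideanSpace ℝ (Fin p)) : Set (EuclideanSpace ℝ (Fin p)) :=
  {w | ∃ t : ℝ, w = u + t • v}


/-- Truncated maximal functions of Birkhoff sums. -/
noncomputable def maxSum {α : Type*} (T : α → α) (g : α → ℝ) : ℕ → α → ℝ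
  | 0, _ => 0
  | n + 1, x => max 0 (g x + maxSum T g n (T x))

lemma maxSum_nonneg {α : Type*} (T : α → α) (g : α → ℝ) (n : ℕ) (x : α) : 0 ≤ maxSum T g n x := by
  cases n with
  | zero => simp [maxSum]
  | succ n => simp [maxSum]

lemma maxSum_mono {α : Type*} (T : α → α) (g : α → ℝ) (n : ℕ) :
    ∀ x, maxSum T g n x ≤ maxSum T g (n + 1) x := by
  induction n with
  | zero => intro x; exact maxSum_nonneg T g 1 x
  | succ n ih =>
    intro x
    rw [maxSum, maxSum]
    have := ih (T x)
    gcongr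

lemma birkhoffSum_le_maxSum {α : Type*} (T : α → α) (g : α → ℝ) (n : ℕ) :
    ∀ x, birkhoffSum T g n x ≤ maxSum T g n x := by
  induction n with
  | zero => intro x; simp [maxSum]
  | succ n ih =>
    intro x
    rw [maxSum, birkhoffSum_succ']
    have := ih (T x)
    exact le_trans (by gcongr) (le_max_right _ _)

lemma maxSum_integrable {α : Type*} [MeasurableSpace α] {μ : Measure α} [IsProbabilityMeasure μ]
    {T : α → α} (hT : MeasurePreserving T μ μ) {g : α → ℝ} (hgi : Integrable g μ) (n : ℕ) :
    Integrable (maxSum T g n) μ := by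
  induction n with
  | zero => exact integrable_const (0 : ℝ)
  | succ n ih =>
    have h1 : Integrable (fun x => maxSum T g n (T x)) μ := hT.integrable_comp_of_integrable ih
    have h2 := (integrable_const (0 : ℝ) (μ := μ)).sup (hgi.add h1)
    exact h2

lemma measurable_birkhoffSum {α : Type*} [MeasurableSpace α]
    {T : α → α} (hT : Measurable T) {g : α → ℝ} (hg : Measurable g) (n : ℕ) :
    Measurable (birkhoffSum T g n) := by
  unfold birkhoffSum
  exact Finset.measurable_sum _ fun i _ => hg.comp (hT.iterate i)

/-- Upper half of the pointwise ergodic theorem. -/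
lemma birkhoff_upper {α : Type*} [MeasurableSpace α] {μ : Measure α} [IsProbabilityMeasure μ]
    {T : α → α} (hT : Ergodic T μ) {f : α → ℝ} (hf : Measurable f) (hfi : Integrable f μ)
    {c : ℝ} (hc : ∫ x, f x ∂μ < c) :
    ∀ᵐ x ∂μ, ∃ C : ℝ, ∀ N : ℕ, birkhoffSum T f N x ≤ c * N + C := by
  set g : α → ℝ := fun x => f x - c with hgdef
  have hg : Measurable g := hf.sub_const c
  have hgi : Integrable g μ := hfi.sub (integrable_const c)
  have hsum : ∀ N x, birkhoffSum T g N x = birkhoffSum T f N x - c * N := by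
    intro N x
    simp [birkhoffSum, hgdef, Finset.sum_sub_distrib, mul_comm]
  let B : Set α := {x | ∃ C : ℕ, ∀ N : ℕ, birkhoffSum T g N x ≤ C}
  have hBm : MeasurableSet B := by
    have : B = ⋃ C : ℕ, ⋂ N : ℕ, {x | birkhoffSum T g N x ≤ C} := by
      ext x; simp [B]
    rw [this]
    exact MeasurableSet.iUnion fun C => MeasurableSet.iInter fun N =>
      measurableSet_le (measurable_birkhoffSum hT.measurable hg N) measurable_const
  have hBinv : T ⁻¹' B = B := by
    ext x
    simp only [Set.mem_preimage, B, Set.mem_ofPred_eq]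
    constructor
    · rintro ⟨C, hC⟩
      refine ⟨⌈|g x| + C⌉₊, fun N => ?_⟩
      have h0 : |g x| + C ≤ (⌈|g x| + C⌉₊ : ℝ) := Nat.le_ceil _
      have hab := le_abs_self (g x)
      cases N with
      | zero => simp
      | succ N =>
        rw [birkhoffSum_succ']
        have := hC N
        linarith
    · rintro ⟨C, hC⟩
      refine ⟨⌈|g x| + C⌉₊, fun N => ?_⟩
      have h0 : |g x| + C ≤ (⌈|g x| + C⌉₊ : ℝ) := Nat.le_ceil _
      have hab := neg_abs_le (g x)
      have := hC (N + 1)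
      rw [birkhoffSum_succ'] at this
      linarith
  have key : ∀ᵐ x ∂μ, x ∈ B := by
    rcases hT.toPreErgodic.ae_mem_or_ae_notMem hBm hBinv with h | h
    · exact h
    · exfalso
      have hMi := maxSum_integrable hT.toMeasurePreserving hgi
      have hint : ∀ n, 0 ≤ ∫ x, max (-(maxSum T g n (T x))) (g x) ∂μ := by
        intro n
        have h1 : ∀ x, max (-(maxSum T g n (T x))) (g x)
            = maxSum T g (n + 1) x - maxSum T g n (T x) := by
          intro x
          rw [maxSum, max_def, max_def]
          split_ifs <;> linarith
        have h2 : ∫ x, maxSum T g n (T x) ∂μ = ∫ x, maxSum T g n x ∂μ := by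
          have := integral_map (μ := μ) hT.measurable.aemeasurable (f := maxSum T g n)
            (by rw [hT.map_eq]; exact (hMi n).aestronglyMeasurable)
          rw [hT.map_eq] at this
          exact this.symm
        simp_rw [h1]
        have hci : Integrable (fun x => maxSum T g n (T x)) μ :=
          hT.toMeasurePreserving.integrable_comp_of_integrable (hMi n)
        rw [integral_sub (hMi _) hci, h2, sub_nonneg]
        exact integral_mono (hMi _) (hMi _) (maxSum_mono T g n)
      have hlim : Tendsto (fun n => ∫ x, max (-(maxSum T g n (T x))) (g x) ∂μ) atTop
          (nhds (∫ x, g x ∂μ)) := by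
        apply tendsto_integral_of_dominated_convergence (fun x => |g x|)
        · intro n
          exact (((hT.toMeasurePreserving.integrable_comp_of_integrable (hMi n)).neg).sup
            hgi).aestronglyMeasurable
        · exact hgi.abs
        · intro n
          filter_upwards with x
          have := maxSum_nonneg T g n (T x)
          rw [Real.norm_eq_abs, abs_le]
          constructor
          · exact le_trans (neg_abs_le _) (le_max_right _ _)
          · apply max_le
            · linarith [abs_nonneg (g x)]
            · exact le_abs_self _
        · filter_upwards [h] with x hx
          have hTx : T x ∉ B := by
            intro h'
            exact hx (hBinv ▸ h')
          simp only [B, Set.mem_ofPred_eq, not_exists, not_forall, not_le] at hTx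
          obtain ⟨N, hN⟩ := hTx ⌈|g x|⌉₊
          apply tendsto_const_nhds.congr'
          filter_upwards [eventually_ge_atTop N] with n hn
          have hm : maxSum T g N (T x) ≤ maxSum T g n (T x) :=
            monotone_nat_of_le_succ (fun n => maxSum_mono T g n (T x)) hn
          have h3 := birkhoffSum_le_maxSum T g N (T x)
          have h4 : |g x| ≤ (⌈|g x|⌉₊ : ℝ) := Nat.le_ceil _
          rw [max_eq_right]
          have := neg_abs_le (g x)
          linarith
      have h0 : 0 ≤ ∫ x, g x ∂μ := ge_of_tendsto' hlim hint
      rw [integral_sub hfi (integrable_const c)] at h0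
      simp at h0
      linarith
  filter_upwards [key] with x hx
  obtain ⟨C, hC⟩ := hx
  refine ⟨C, fun N => ?_⟩
  have := hC N
  rw [hsum] at this
  linarith


lemma truncation {α : Type*} [MeasurableSpace α] {μ : Measure α} [IsProbabilityMeasure μ]
    {f h : α → ℝ} (hf : Measurable f) (hhi : Integrable h μ)
    (hh0 : ∀ x, 0 ≤ h x) (hfh : ∀ x, f x ≤ h x) {c : ℝ}
    (H : ¬ (Integrable f μ ∧ c ≤ ∫ x, f x ∂μ)) :
    ∃ B : ℕ, Integrable (fun x => max (f x) (-(B : ℝ))) μ ∧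
      ∫ x, max (f x) (-(B : ℝ)) ∂μ < c := by
  have hmaxi : ∀ B : ℕ, Integrable (fun x => max (f x) (-(B : ℝ))) μ := by
    intro B
    refine Integrable.mono' (hhi.add (integrable_const (B : ℝ)))
      (hf.max measurable_const).aestronglyMeasurable ?_
    filter_upwards with x
    have h1 := hh0 x
    have h2 := hfh x
    have h3 : (0 : ℝ) ≤ B := Nat.cast_nonneg _
    simp only [Pi.add_apply]
    rw [Real.norm_eq_abs, abs_le]
    constructor
    · exact le_trans (by linarith) (le_max_right _ _)
    · exact max_le (by linarith) (by linarith)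
  by_contra hcon
  push Not at hcon
  have hcon' : ∀ B : ℕ, c ≤ ∫ x, max (f x) (-(B : ℝ)) ∂μ := fun B => hcon B (hmaxi B)
  apply H
  have hptw : ∀ x, Tendsto (fun B : ℕ => max (f x) (-(B : ℝ))) atTop (nhds (f x)) := by
    intro x
    apply tendsto_const_nhds.congr'
    filter_upwards [eventually_ge_atTop ⌈-(f x)⌉₊] with B hB
    have : -(f x) ≤ B := le_trans (Nat.le_ceil _) (by exact_mod_cast hB)
    rw [max_eq_left]; linarith
  have hfi : Integrable f μ := by
    have hgi : Integrable (fun x => h x - f x) μ := by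
      refine ⟨(hhi.aestronglyMeasurable.sub hf.aestronglyMeasurable), ?_⟩
      rw [hasFiniteIntegral_iff_ofReal (by filter_upwards with x; simpa using hfh x)]
      have hF : ∫⁻ x, ENNReal.ofReal (h x - f x) ∂μ ≤
          liminf (fun B : ℕ => ∫⁻ x, ENNReal.ofReal (h x - max (f x) (-(B : ℝ))) ∂μ) atTop := by
        refine le_trans (lintegral_mono_ae ?_) (lintegral_liminf_le' ?_)
        · filter_upwards with x
          have : Tendsto (fun B : ℕ => ENNReal.ofReal (h x - max (f x) (-(B : ℝ)))) atTop
              (nhds (ENNReal.ofReal (h x - f x))) :=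
            ENNReal.tendsto_ofReal (tendsto_const_nhds.sub (hptw x))
          rw [this.liminf_eq]
        · intro B
          exact (hhi.aestronglyMeasurable.aemeasurable.sub
            (hf.max measurable_const).aemeasurable).ennreal_ofReal
      refine lt_of_le_of_lt hF (lt_of_le_of_lt (b := ENNReal.ofReal (∫ x, h x ∂μ - c)) ?_
        ENNReal.ofReal_lt_top)
      have hb : ∀ B : ℕ, ∫⁻ x, ENNReal.ofReal (h x - max (f x) (-(B : ℝ))) ∂μ ≤
          ENNReal.ofReal (∫ x, h x ∂μ - c) := by
        intro B
        have hsi : Integrable (fun x => h x - max (f x) (-(B : ℝ))) μ := hhi.sub (hmaxi B)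
        rw [← ofReal_integral_eq_lintegral_ofReal hsi]
        · apply ENNReal.ofReal_le_ofReal
          have := integral_sub hhi (hmaxi B)
          have h2 := hcon' B
          linarith
        · filter_upwards with x
          have h1 := hh0 x
          have h2 := hfh x
          have h3 : (0 : ℝ) ≤ B := Nat.cast_nonneg _
          simp only [Pi.zero_apply, sub_nonneg]
          exact max_le h2 (by linarith)
      exact le_trans (liminf_le_liminf (Eventually.of_forall hb)) (by simp)
    have := hhi.sub hgi
    refine this.congr ?_
    filter_upwards with x
    simp
  refine ⟨hfi, ?_⟩
  have hlim : Tendsto (fun B : ℕ => ∫ x, max (f x) (-(B : ℝ)) ∂μ) atTop (nhds (∫ x, f x ∂μ)) := by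
    apply tendsto_integral_of_dominated_convergence (fun x => |f x|)
    · intro B; exact (hmaxi B).aestronglyMeasurable
    · exact hfi.abs
    · intro B
      filter_upwards with x
      have h3 : (0 : ℝ) ≤ B := Nat.cast_nonneg _
      rw [Real.norm_eq_abs, abs_le]
      constructor
      · exact le_trans (neg_abs_le _) (le_max_left _ _)
      · exact max_le (le_abs_self _) (by linarith [abs_nonneg (f x)])
    · filter_upwards with x using hptw x
  exact ge_of_tendsto' hlim hcon'


/-- The easy half of the subadditive ergodic theorem. -/
lemma kingman_upper {α : Type*} [MeasurableSpace α] {μ : Measure α} [IsProbabilityMeasure μ]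
    {T : α → α} (hT : Ergodic T μ) {a : ℕ → α → ℝ} (ham : ∀ n, Measurable (a n))
    (hsub : ∀ n m x, a (n + m) x ≤ a n x + a m (T^[n] x)) (ha0 : ∀ x, a 0 x ≤ 0)
    {h : α → ℝ} (hhm : Measurable h) (hhi : Integrable h μ) (hh0 : ∀ x, 0 ≤ h x)
    (ha1 : ∀ x, a 1 x ≤ h x) {c : ℝ} {n : ℕ} (hn : 1 ≤ n)
    (H : ¬ (Integrable (a n) μ ∧ c * n ≤ ∫ x, a n x ∂μ)) :
    ∀ᵐ x ∂μ, ∃ C : ℝ, ∀ N : ℕ, a N x ≤ c * N + C := by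
  have hnpos : (0 : ℝ) < n := by exact_mod_cast hn
  have hah : ∀ m x, a m x ≤ birkhoffSum T h m x := by
    intro m
    induction m with
    | zero => intro x; simpa using ha0 x
    | succ m ih =>
      intro x
      rw [birkhoffSum_succ']
      have h1 := hsub 1 m x
      have h2 := ih (T x)
      have h3 := ha1 x
      rw [add_comm 1 m] at h1
      simp only [Function.iterate_one] at h1
      linarith
  have hSh0 : ∀ m x, 0 ≤ birkhoffSum T h m x := by
    intro m x
    exact Finset.sum_nonneg fun i _ => hh0 _
  have hHi : Integrable (birkhoffSum T h n) μ := by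
    unfold birkhoffSum
    exact integrable_finsetSum _ fun i _ =>
      (hT.toMeasurePreserving.iterate i).integrable_comp_of_integrable hhi
  obtain ⟨B, hfi, hfc⟩ := truncation (ham n) hHi (hSh0 n) (hah n) H
  set f : α → ℝ := fun x => max (a n x) (-(B : ℝ)) with hfdef
  have hfm : Measurable f := (ham n).max measurable_const
  obtain ⟨c1, hc1, hc1'⟩ := exists_between hfc
  set δ := (c * n - c1) / (2 * n) with hδ
  have hδpos : 0 < δ := div_pos (by linarith) (by positivity)
  have hδe : 2 * n * δ = c * n - c1 := by rw [hδ]; field_simp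
  have e1 := birkhoff_upper hT hfm hfi hc1
  have e2 := birkhoff_upper hT hhm hhi (c := ∫ x, h x ∂μ + δ) (by linarith)
  have e3 := birkhoff_upper hT hhm.neg hhi.neg (c := -∫ x, h x ∂μ + δ) (by
    have : ∫ x, (-h) x ∂μ = - ∫ x, h x ∂μ := integral_neg _
    linarith)
  let R : ℕ → α → ℝ := fun M x => ∑ s ∈ Finset.range n, a (M + n - s) (T^[s] x)
  have hR1 : ∀ M x, R (M + 1) x ≤ f x + R M (T x) := by
    intro M x
    have h1 : ∑ s ∈ Finset.range (n + 1), a (M + 1 + n - s) (T^[s] x) =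
        R (M + 1) x + a (M + 1) (T^[n] x) := by
      rw [Finset.sum_range_succ]
      simp only [R, Nat.add_sub_cancel]
    have h2 : ∑ s ∈ Finset.range (n + 1), a (M + 1 + n - s) (T^[s] x) =
        R M (T x) + a (M + 1 + n) x := by
      rw [Finset.sum_range_succ']
      simp only [R, Function.iterate_zero, id, Nat.sub_zero]
      congr 1
      apply Finset.sum_congr rfl
      intro s _
      rw [Function.iterate_succ_apply]
      congr 1
      omega
    have h3 := hsub n (M + 1) x
    rw [add_comm n] at h3
    have h4 : a n x ≤ f x := le_max_left _ _
    linarith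
  have hR2 : ∀ M x, R M x ≤ birkhoffSum T f M x + R 0 (T^[M] x) := by
    intro M
    induction M with
    | zero => intro x; simp
    | succ M ih =>
      intro x
      rw [birkhoffSum_succ', Function.iterate_succ_apply]
      have := hR1 M x
      have := ih (T x)
      linarith
  have hR0 : ∀ y, R 0 y ≤ n * birkhoffSum T h n y := by
    intro y
    have : ∀ s ∈ Finset.range n, a (0 + n - s) (T^[s] y) ≤ birkhoffSum T h n y := by
      intro s hs
      have hs' : s < n := Finset.mem_range.1 hs
      have e : s + (n - s) = n := by omega
      have h1 := birkhoffSum_add T h s (n - s) y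
      rw [e] at h1
      have h2 := hah (n - s) (T^[s] y)
      have h3 := hSh0 s y
      rw [zero_add]
      linarith
    have h2 := Finset.sum_le_sum this
    simpa [R] using h2
  filter_upwards [e1, e2, e3] with x ⟨C1, h1⟩ ⟨C2, h2⟩ ⟨C3, h3⟩
  set I := ∫ x, h x ∂μ with hI
  set K := ∑ s ∈ Finset.range n, (|a s x| + |c * s|) with hK
  have hK0 : 0 ≤ K := Finset.sum_nonneg fun i _ => by positivity
  set C0 := (K + |C1| + n * (|C2| + |C3| + |I + δ| * n) + |c * n| * n) with hC0
  have hC00 : 0 ≤ C0 := by positivity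
  refine ⟨C0, fun N => ?_⟩
  by_cases hN : N < n
  · have t1 : |a N x| + |c * N| ≤ K :=
      Finset.single_le_sum (f := fun s : ℕ => |a s x| + |c * s|) (fun i _ => by positivity)
        (Finset.mem_range.2 hN)
    have t2 := le_abs_self (a N x)
    have t3 := neg_abs_le (c * N)
    have : K ≤ C0 := by
      have : 0 ≤ |C1| + n * (|C2| + |C3| + |I + δ| * n) + |c * n| * n := by positivity
      rw [hC0]; linarith
    linarith
  · obtain ⟨M, rfl⟩ : ∃ M, N = M + n := ⟨N - n, by omega⟩
    have s1 : (n : ℝ) * a (M + n) x ≤ ∑ s ∈ Finset.range n, a s x + R M x := by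
      have : ∀ s ∈ Finset.range n, a (M + n) x ≤ a s x + a (M + n - s) (T^[s] x) := by
        intro s hs
        have hs' : s < n := Finset.mem_range.1 hs
        have := hsub s (M + n - s) x
        rwa [show s + (M + n - s) = M + n by omega] at this
      have := Finset.sum_le_sum this
      rw [Finset.sum_add_distrib] at this
      simpa using this
    have s2 : ∑ s ∈ Finset.range n, a s x ≤ K := by
      apply Finset.sum_le_sum
      intro s _
      linarith [le_abs_self (a s x), abs_nonneg (c * s)]
    have s3 := hR2 M x
    have s4 := hR0 (T^[M] x)
    have s5 := birkhoffSum_add T h M n x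
    have s6 := h1 M
    have s7 := h2 (M + n)
    have s8 := h3 M
    have s9 : birkhoffSum T (-h) M x = - birkhoffSum T h M x := by
      simp [birkhoffSum]
    rw [s9] at s8
    push_cast at s7 ⊢
    have s10 : birkhoffSum T h n (T^[M] x) ≤ 2 * δ * M + (|C2| + |C3| + |I + δ| * n) := by
      have t1 := le_abs_self C2
      have t2 := le_abs_self C3
      have t3 : (I + δ) * n ≤ |I + δ| * n := by gcongr; exact le_abs_self _
      linarith
    have s11 : (n : ℝ) * birkhoffSum T h n (T^[M] x) ≤
        n * (2 * δ * M + (|C2| + |C3| + |I + δ| * n)) := by gcongr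
    have s12 := le_abs_self C1
    have s13 : (n : ℝ) * (2 * δ * M) + c1 * M = c * n * M := by
      have : (n : ℝ) * (2 * δ * M) = (2 * n * δ) * M := by ring
      rw [this, hδe]; ring
    have s14 := neg_abs_le (c * n)
    have s15 : 0 ≤ (|c * n| + c * n) * n := mul_nonneg (by linarith) hnpos.le
    have s16 : (n : ℝ) * a (M + n) x ≤ c * n * (M + n) + C0 := by
      rw [hC0]; linarith
    have s17 : C0 ≤ n * C0 := by
      have : (1 : ℝ) ≤ n := by exact_mod_cast hn
      exact le_mul_of_one_le_left hC00 this
    have s18 : (n : ℝ) * a (M + n) x ≤ n * (c * (M + n) + C0) := by linarith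
    exact le_of_mul_le_mul_left s18 hnpos


lemma measurableSet_exists_le {α X : Type*} [MeasurableSpace α] [PseudoMetricSpace X]
    [CompactSpace X] {F : α → X → ℝ} (hc : ∀ x, Continuous (F x))
    (hm : ∀ z, Measurable fun x => F x z) : MeasurableSet {x | ∃ z, F x z ≤ 0} := by
  cases isEmpty_or_nonempty X with
  | inl h => simp
  | inr h =>
    have : {x | ∃ z, F x z ≤ 0} =
        ⋂ k : ℕ, ⋃ i : ℕ, {x | F x (TopologicalSpace.denseSeq X i) < 1 / ((k : ℝ) + 1)} := by
      ext x
      simp only [Set.mem_iInter, Set.mem_iUnion, Set.mem_ofPred_eq]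
      constructor
      · rintro ⟨z, hz⟩ k
        have hopen : IsOpen {y | F x y < 1 / ((k : ℝ) + 1)} :=
          isOpen_lt (hc x) continuous_const
        have hne : ({y | F x y < 1 / ((k : ℝ) + 1)}).Nonempty :=
          ⟨z, lt_of_le_of_lt hz (by positivity)⟩
        exact (TopologicalSpace.denseRange_denseSeq X).exists_mem_open hopen hne
      · intro hk
        obtain ⟨z, -, hz⟩ := isCompact_univ.exists_isMinOn (Set.univ_nonempty (α := X))
          (hc x).continuousOn
        refine ⟨z, ?_⟩
        by_contra hpos
        push Not at hpos
        obtain ⟨k, hk'⟩ := exists_nat_one_div_lt hpos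
        obtain ⟨i, hi⟩ := hk k
        have := hz (Set.mem_univ (TopologicalSpace.denseSeq X i))
        simp only [Set.mem_ofPred_eq] at this
        linarith
    rw [this]
    exact MeasurableSet.iInter fun k => MeasurableSet.iUnion fun i =>
      measurableSet_lt (hm _) measurable_const

section Pliss

variable {α : Type*} {H : Type*} [NormedAddCommGroup H] [NormedSpace ℝ H]

/-- Points at which some unit vector is contracted backwards, up to time `m`. -/
def plissSet (D : ℕ → α → H →L[ℝ] H) (c : ℝ) (m : ℕ) : Set α :=
  {x | ∃ e : H, ‖e‖ = 1 ∧ ∀ j ≤ m, ∃ f : H, D j x f = e ∧ ‖f‖ ≤ Real.exp (-(c * j))}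

lemma plissSet_antitone (D : ℕ → α → H →L[ℝ] H) (c : ℝ) : Antitone (plissSet D c) := by
  intro m n hmn x
  rintro ⟨e, he, h⟩
  exact ⟨e, he, fun j hj => h j (hj.trans hmn)⟩

lemma plissSet_iff {T : α → α} {D : ℕ → α → H →L[ℝ] H}
    (hD : ∀ n m x, D (n + m) x = (D n x).comp (D m (T^[n] x)))
    (hinj : ∀ n x, Function.Injective (D n x)) (c : ℝ) (m : ℕ) (x : α) :
    x ∈ plissSet D c m ↔ ∃ z : H, ‖z‖ = 1 ∧ ∀ j ≤ m,
      ‖D (m - j) (T^[j] x) z‖ ≤ Real.exp (-(c * j)) * ‖D m x z‖ := by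
  have hsplit : ∀ j ≤ m, ∀ z, D j x (D (m - j) (T^[j] x) z) = D m x z := by
    intro j hj z
    have := hD j (m - j) x
    rw [show j + (m - j) = m by omega] at this
    rw [this]; rfl
  constructor
  · rintro ⟨e, he, h⟩
    obtain ⟨f, hf, hf'⟩ := h m le_rfl
    have hf0 : f ≠ 0 := by
      rintro rfl
      simp at hf; rw [← hf] at he; simp at he
    have hfp : 0 < ‖f‖ := norm_pos_iff.2 hf0
    refine ⟨‖f‖⁻¹ • f, by rw [norm_smul, norm_inv, norm_norm]; field_simp, fun j hj => ?_⟩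
    obtain ⟨g, hg, hg'⟩ := h j hj
    have : D (m - j) (T^[j] x) f = g := by
      apply hinj j x
      rw [hsplit j hj, hf, hg]
    rw [map_smul, map_smul, this, hf, norm_smul, norm_smul, he, norm_inv, norm_norm]
    have : ‖f‖⁻¹ * ‖g‖ ≤ ‖f‖⁻¹ * Real.exp (-(c * j)) := by gcongr
    linarith
  · rintro ⟨z, hz, h⟩
    have hz0 : z ≠ 0 := by rintro rfl; simp at hz
    have hDz : D m x z ≠ 0 := by
      intro h0
      exact hz0 (hinj m x (by rw [h0, map_zero]))
    have hp : 0 < ‖D m x z‖ := norm_pos_iff.2 hDz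
    refine ⟨‖D m x z‖⁻¹ • D m x z, by rw [norm_smul, norm_inv, norm_norm]; field_simp,
      fun j hj => ⟨‖D m x z‖⁻¹ • D (m - j) (T^[j] x) z, ?_, ?_⟩⟩
    · rw [map_smul, hsplit j hj]
    · rw [norm_smul, norm_inv, norm_norm, inv_mul_le_iff₀ hp]
      have := h j hj
      linarith

lemma plissSet_measurable [MeasurableSpace α] [FiniteDimensional ℝ H] {T : α → α}
    (hTm : Measurable T) {D : ℕ → α → H →L[ℝ] H}
    (hD : ∀ n m x, D (n + m) x = (D n x).comp (D m (T^[n] x)))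
    (hinj : ∀ n x, Function.Injective (D n x))
    (hDm : ∀ n z, Measurable fun x => ‖D n x z‖) (c : ℝ) (m : ℕ) :
    MeasurableSet (plissSet D c m) := by
  have : ProperSpace H := FiniteDimensional.proper ℝ H
  have : CompactSpace (Metric.sphere (0 : H) 1) :=
    isCompact_iff_compactSpace.1 (isCompact_sphere 0 1)
  have : plissSet D c m = {x | ∃ z : Metric.sphere (0 : H) 1, (∑ j ∈ Finset.range (m + 1),
      max 0 (‖D (m - j) (T^[j] x) z‖ - Real.exp (-(c * j)) * ‖D m x z‖)) ≤ 0} := by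
    ext x
    rw [plissSet_iff hD hinj]
    simp only [Set.mem_ofPred_eq, Subtype.exists, mem_sphere_zero_iff_norm, exists_prop]
    refine exists_congr fun z => and_congr_right fun _ => ?_
    constructor
    · intro h
      apply le_of_eq
      apply Finset.sum_eq_zero
      intro j hj
      rw [max_eq_left]
      have := h j (by have := Finset.mem_range.1 hj; omega)
      linarith
    · intro h j hj
      have h1 := Finset.single_le_sum (f := fun j : ℕ =>
        max 0 (‖D (m - j) (T^[j] x) z‖ - Real.exp (-(c * j)) * ‖D m x z‖))
        (fun i _ => le_max_left _ _) (Finset.mem_range.2 (Nat.lt_succ_of_le hj))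
      have h2 := le_max_right 0 (‖D (m - j) (T^[j] x) z‖ - Real.exp (-(c * j)) * ‖D m x z‖)
      linarith
  rw [this]
  apply measurableSet_exists_le
  · intro x
    fun_prop
  · intro z
    refine Finset.measurable_sum _ fun j _ => measurable_const.max ?_
    exact ((hDm (m - j) z).comp (hTm.iterate j)).sub ((hDm m z).const_mul _)

lemma plissSet_iInter [FiniteDimensional ℝ H] {D : ℕ → α → H →L[ℝ] H} {c : ℝ} {x : α}
    (hx : ∀ m, x ∈ plissSet D c m) :
    ∃ e : H, ‖e‖ = 1 ∧ ∀ j, ∃ f : H, D j x f = e ∧ ‖f‖ ≤ Real.exp (-(c * j)) := by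
  have : ProperSpace H := FiniteDimensional.proper ℝ H
  let K : ℕ → Set H := fun m => Metric.sphere (0 : H) 1 ∩
    ⋂ j ∈ Set.Iic m, (D j x) '' Metric.closedBall 0 (Real.exp (-(c * j)))
  have hcl : ∀ m, IsClosed (⋂ j ∈ Set.Iic m,
      (D j x) '' Metric.closedBall (0 : H) (Real.exp (-(c * j)))) := by
    intro m
    exact isClosed_biInter fun j _ =>
      ((isCompact_closedBall 0 _).image (D j x).continuous).isClosed
  have hne := IsCompact.nonempty_iInter_of_sequence_nonempty_isCompact_isClosed K
    (fun m => by
      refine Set.inter_subset_inter_right _ ?_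
      intro e he
      simp only [Set.mem_iInter] at he ⊢
      intro j hj
      exact he j (le_trans hj (Nat.le_succ m)))
    (fun m => by
      obtain ⟨e, he, h⟩ := hx m
      refine ⟨e, by simpa using he, ?_⟩
      simp only [Set.mem_iInter]
      intro j hj
      obtain ⟨f, hf, hf'⟩ := h j hj
      exact ⟨f, by simpa using hf', hf⟩)
    ((isCompact_sphere 0 1).inter_right (hcl 0))
    (fun m => (isCompact_sphere 0 1).isClosed.inter (hcl m))
  obtain ⟨e, he⟩ := hne
  simp only [Set.mem_iInter] at he
  refine ⟨e, by simpa using (he 0).1, fun j => ?_⟩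
  have h1 := (he j).2
  simp only [Set.mem_iInter] at h1
  obtain ⟨f, hf, hf'⟩ := h1 j (Set.mem_Iic.2 le_rfl)
  exact ⟨f, hf', by simpa using hf⟩

open Classical in
lemma pliss_key {T : α → α} {D : ℕ → α → H →L[ℝ] H}
    (hD0 : ∀ x, D 0 x = ContinuousLinearMap.id ℝ H)
    (hD : ∀ n m x, D (n + m) x = (D n x).comp (D m (T^[n] x)))
    (hinj : ∀ n x, Function.Injective (D n x)) (c : ℝ) (N : ℕ) :
    ∀ (x : α) (z : H), ‖z‖ = 1 → Real.log ‖D N x z‖ - c * N ≤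
      ∑ i ∈ Finset.range N, (plissSet D c (N - i)).indicator
        (fun y => max 0 (Real.log ‖D 1 y‖ - c)) (T^[i] x) := by
  induction N using Nat.strong_induction_on with
  | _ N ih =>
    intro x z hz
    have hz0 : z ≠ 0 := by rintro rfl; simp at hz
    have hpos : ∀ n y, 0 < ‖D n y z‖ := by
      intro n y
      apply norm_pos_iff.2
      intro h0
      exact hz0 (hinj n y (by rw [h0, map_zero]))
    have hind0 : ∀ m y, 0 ≤ (plissSet D c m).indicator
        (fun y => max 0 (Real.log ‖D 1 y‖ - c)) y :=
      fun m y => Set.indicator_nonneg (fun y _ => le_max_left _ _) y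
    cases N with
    | zero => simp [hD0, hz]
    | succ N =>
      by_cases hx : x ∈ plissSet D c (N + 1)
      · rw [Finset.sum_range_succ']
        simp only [Function.iterate_succ_apply, Function.iterate_zero, id, Nat.sub_zero,
          Nat.add_sub_add_right]
        rw [Set.indicator_of_mem hx]
        have h1 := ih N (Nat.lt_succ_self N) (T x) z hz
        have h2 := hD 1 N x
        rw [add_comm 1 N, Function.iterate_one] at h2
        have h3 : ‖D (N + 1) x z‖ ≤ ‖D 1 x‖ * ‖D N (T x) z‖ := by
          rw [h2]; exact (D 1 x).le_opNorm _
        have h4 : 0 < ‖D 1 x‖ := by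
          by_contra hc
          have : ‖D 1 x‖ * ‖D N (T x) z‖ ≤ 0 :=
            mul_nonpos_of_nonpos_of_nonneg (not_lt.1 hc) (norm_nonneg _)
          linarith [hpos (N + 1) x]
        have h5 := Real.log_le_log (hpos (N + 1) x) h3
        rw [Real.log_mul h4.ne' (hpos N (T x)).ne'] at h5
        have h6 := le_max_right 0 (Real.log ‖D 1 x‖ - c)
        push_cast
        linarith
      · have hx' := hx
        rw [plissSet_iff hD hinj] at hx'
        push Not at hx'
        obtain ⟨j, hj, hlt⟩ := hx' z hz
        have hj0 : j ≠ 0 := by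
          rintro rfl
          simp at hlt
        have h1 := ih (N + 1 - j) (by omega) (T^[j] x) z hz
        have h2 := Real.log_lt_log (mul_pos (Real.exp_pos _) (hpos _ _)) hlt
        rw [Real.log_mul (Real.exp_pos _).ne' (hpos _ _).ne', Real.log_exp] at h2
        have h3 : ∑ i ∈ Finset.range (N + 1 - j), (plissSet D c (N + 1 - j - i)).indicator
            (fun y => max 0 (Real.log ‖D 1 y‖ - c)) (T^[i] (T^[j] x)) ≤
            ∑ i ∈ Finset.range (N + 1), (plissSet D c (N + 1 - i)).indicator
            (fun y => max 0 (Real.log ‖D 1 y‖ - c)) (T^[i] x) := by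
          have e : N + 1 = j + (N + 1 - j) := by omega
          conv_rhs => rw [e]
          rw [Finset.sum_range_add]
          have : ∀ i, (plissSet D c (j + (N + 1 - j) - (j + i))).indicator
            (fun y => max 0 (Real.log ‖D 1 y‖ - c)) (T^[j + i] x) =
            (plissSet D c (N + 1 - j - i)).indicator
            (fun y => max 0 (Real.log ‖D 1 y‖ - c)) (T^[i] (T^[j] x)) := by
            intro i
            rw [Nat.add_sub_add_left, add_comm j i, Function.iterate_add_apply]
          simp_rw [this]
          have := Finset.sum_nonneg (s := Finset.range j)
            (f := fun i => (plissSet D c (j + (N + 1 - j) - i)).indicator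
              (fun y => max 0 (Real.log ‖D 1 y‖ - c)) (T^[i] x)) (fun i _ => hind0 _ _)
          linarith
        have h4 : ((N + 1 - j : ℕ) : ℝ) = (N + 1 : ℕ) - j := Nat.cast_sub hj
        rw [h4] at h1
        linarith

lemma pliss [MeasurableSpace α] {μ : Measure α} [IsProbabilityMeasure μ]
    [FiniteDimensional ℝ H] [Nontrivial H] {T : α → α}
    (hT : MeasurePreserving T μ μ) {D : ℕ → α → H →L[ℝ] H}
    (hD0 : ∀ x, D 0 x = ContinuousLinearMap.id ℝ H)
    (hD : ∀ n m x, D (n + m) x = (D n x).comp (D m (T^[n] x)))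
    (hinj : ∀ n x, Function.Injective (D n x))
    (hDm : ∀ n z, Measurable fun x => ‖D n x z‖) {c c' : ℝ} (hcc : c' < c)
    (hDi : ∀ n ≥ 1, Integrable (fun x => Real.log ‖D n x‖) μ ∧
      c * n ≤ ∫ x, Real.log ‖D n x‖ ∂μ) :
    ∃ G : Set α, MeasurableSet G ∧ μ G ≠ 0 ∧ ∀ x ∈ G, ∃ e : H, ‖e‖ = 1 ∧
      ∀ j : ℕ, ∃ f : H, D j x f = e ∧ ‖f‖ ≤ Real.exp (-(c' * j)) := by
  have hGm := plissSet_measurable hT.measurable hD hinj hDm c'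
  refine ⟨⋂ m, plissSet D c' m, MeasurableSet.iInter hGm, ?_, fun x hx =>
    plissSet_iInter (Set.mem_iInter.1 hx)⟩
  intro hzero
  set a : α → ℝ := fun y => max 0 (Real.log ‖D 1 y‖ - c') with ha
  have hai : Integrable a μ := by
    have h1 : Integrable (fun y => Real.log ‖D 1 y‖ - c') μ :=
      ((hDi 1 le_rfl).1).sub (integrable_const c')
    exact (integrable_const (0 : ℝ)).sup h1
  have hDpos : ∀ n x, 0 < ‖D n x‖ := by
    intro n x
    obtain ⟨z, hz⟩ := exists_ne (0 : H)
    have h1 : D n x z ≠ 0 := fun h0 => hz (hinj n x (by rw [h0, map_zero]))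
    apply norm_pos_iff.2
    intro h0
    rw [h0] at h1
    simp at h1
  have hlog : ∀ N x, Real.log ‖D N x‖ ≤ c' * N +
      ∑ i ∈ Finset.range N, (plissSet D c' (N - i)).indicator a (T^[i] x) := by
    intro N x
    rw [Real.log_le_iff_le_exp (hDpos N x)]
    apply ContinuousLinearMap.opNorm_le_bound _ (Real.exp_pos _).le
    intro z
    by_cases hz : z = 0
    · simp [hz]
    have hzp : 0 < ‖z‖ := norm_pos_iff.2 hz
    have h1 := pliss_key hD0 hD hinj c' N x (‖z‖⁻¹ • z)
      (by rw [norm_smul, norm_inv, norm_norm]; field_simp)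
    have hne : D N x z ≠ 0 := fun h0 => hz (hinj N x (by rw [h0, map_zero]))
    have hp : 0 < ‖D N x z‖ := norm_pos_iff.2 hne
    rw [map_smul, norm_smul, norm_inv, norm_norm] at h1
    have h2 : Real.log (‖z‖⁻¹ * ‖D N x z‖) ≤ c' * N +
      ∑ i ∈ Finset.range N, (plissSet D c' (N - i)).indicator a (T^[i] x) := by linarith
    rw [Real.log_le_iff_le_exp (by positivity), inv_mul_le_iff₀ hzp] at h2
    linarith
  have hbi : ∀ m, Integrable ((plissSet D c' m).indicator a) μ :=
    fun m => hai.indicator (hGm m)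
  set b : ℕ → ℝ := fun m => ∫ x in plissSet D c' m, a x ∂μ with hb
  have hbT : ∀ m i, ∫ x, (plissSet D c' m).indicator a (T^[i] x) ∂μ = b m := by
    intro m i
    have hTi := hT.iterate i
    have := integral_map (μ := μ) hTi.measurable.aemeasurable
      (f := (plissSet D c' m).indicator a)
      (by rw [hTi.map_eq]; exact (hbi m).aestronglyMeasurable)
    rw [hTi.map_eq] at this
    rw [← this, integral_indicator (hGm m)]
  have hN : ∀ N : ℕ, 1 ≤ N → (c - c') * N ≤ ∑ i ∈ Finset.range N, b (i + 1) := by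
    intro N hN
    obtain ⟨h1, h2⟩ := hDi N hN
    have hci : ∀ i, Integrable (fun x => (plissSet D c' (N - i)).indicator a (T^[i] x)) μ :=
      fun i => (hT.iterate i).integrable_comp_of_integrable (hbi (N - i))
    have h3 : ∫ x, Real.log ‖D N x‖ ∂μ ≤ ∫ x, (c' * N +
      ∑ i ∈ Finset.range N, (plissSet D c' (N - i)).indicator a (T^[i] x)) ∂μ :=
      integral_mono h1 ((integrable_const _).add (integrable_finsetSum _ fun i _ => hci i))
        (hlog N)
    rw [integral_add (integrable_const _) (integrable_finsetSum _ fun i _ => hci i),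
      integral_finsetSum _ (fun i _ => hci i)] at h3
    simp_rw [hbT] at h3
    have h4 : ∑ i ∈ Finset.range N, b (N - i) = ∑ i ∈ Finset.range N, b (i + 1) := by
      rw [← Finset.sum_range_reflect]
      apply Finset.sum_congr rfl
      intro i hi
      have := Finset.mem_range.1 hi
      congr 1
      omega
    rw [h4] at h3
    simp at h3
    linarith
  have hblim : Tendsto b atTop (nhds 0) := by
    have h1 := tendsto_setIntegral_of_antitone (μ := μ) (f := a) hGm (plissSet_antitone D c')
      ⟨0, hai.integrableOn⟩
    rwa [Measure.restrict_eq_zero.2 hzero, integral_zero_measure] at h1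
  have hces := ((tendsto_add_atTop_iff_nat 1).2 hblim).cesaro
  have : c - c' ≤ 0 := by
    apply ge_of_tendsto hces
    filter_upwards [eventually_ge_atTop 1] with N h1
    have := hN N h1
    have hNp : (0 : ℝ) < N := by exact_mod_cast h1
    rw [le_inv_mul_iff₀ hNp]
    linarith
  linarith

end Pliss


section Forms

open ContinuousAlternatingMap

variable {E : Type*} [NormedAddCommGroup E] [NormedSpace ℝ E]

/-- Pull-back of alternating `k`-forms. -/
noncomputable def pull (k : ℕ) (L : E →L[ℝ] E) :
    (E [⋀^Fin k]→L[ℝ] ℝ) →L[ℝ] (E [⋀^Fin k]→L[ℝ] ℝ) :=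
  compContinuousLinearMapCLM L

lemma pull_apply (k : ℕ) (L : E →L[ℝ] E) (f : E [⋀^Fin k]→L[ℝ] ℝ) (v : Fin k → E) :
    pull k L f v = f (fun i => L (v i)) := rfl

lemma pull_comp (k : ℕ) (L M : E →L[ℝ] E) : pull k (L.comp M) = (pull k M).comp (pull k L) := by
  ext f v; rfl

lemma pull_id (k : ℕ) : pull k (ContinuousLinearMap.id ℝ E) = ContinuousLinearMap.id ℝ _ := by
  ext f v; rfl

lemma pull_injective (k : ℕ) (L : E ≃L[ℝ] E) :
    Function.Injective (pull k (L : E →L[ℝ] E)) := by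
  intro f g h
  ext v
  have := congrArg (fun F => F (fun i => L.symm (v i))) h
  simpa [pull_apply] using this

lemma norm_pull_le (k : ℕ) (L : E →L[ℝ] E) : ‖pull k L‖ ≤ ‖L‖ ^ k := by
  apply ContinuousLinearMap.opNorm_le_bound _ (by positivity)
  intro f
  have := norm_compContinuousLinearMap_le f L
  rw [Fintype.card_fin] at this
  rw [mul_comm]
  exact this

lemma forms_finiteDimensional [FiniteDimensional ℝ E] (k : ℕ) :
    FiniteDimensional ℝ (E [⋀^Fin k]→L[ℝ] ℝ) := by
  let φ : (E [⋀^Fin k]→L[ℝ] ℝ) →ₗ[ℝ] MultilinearMap ℝ (fun _ : Fin k => E) ℝ :=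
    (AlternatingMap.toMultilinearMapLM (S := ℝ)).comp (toAlternatingMapLinear (R := ℝ))
  apply FiniteDimensional.of_injective φ
  intro f g h
  ext v
  have := congrArg (fun F => F v) h
  exact this

lemma forms_trivial [FiniteDimensional ℝ E] {k : ℕ} (hk : Module.finrank ℝ E < k)
    (f : E [⋀^Fin k]→L[ℝ] ℝ) : f = 0 := by
  ext v
  apply f.toAlternatingMap.map_linearDependent v
  intro h
  have := h.fintype_card_le_finrank
  simp at this
  omega

lemma forms_ii {k : ℕ} {L : E →L[ℝ] E} {e f : E [⋀^Fin (k + 1)]→L[ℝ] ℝ}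
    (h : pull (k + 1) L f = e) (w : E) :
    ‖e.curryLeft w‖ ≤ ‖pull k L‖ * ‖f‖ * ‖L w‖ := by
  have h1 : e.curryLeft w = pull k L (f.curryLeft (L w)) := by
    rw [← h]; exact curryLeft_compContinuousLinearMap f L w
  rw [h1]
  have h2 := (pull k L).le_opNorm (f.curryLeft (L w))
  have h3 := f.curryLeft.le_opNorm (L w)
  rw [norm_curryLeft] at h3
  calc _ ≤ _ := h2
    _ ≤ ‖pull k L‖ * (‖f‖ * ‖L w‖) := by gcongr
    _ = _ := by ring

lemma forms_i {k : ℕ} {L : E →L[ℝ] E} {e f : E [⋀^Fin (k + 1)]→L[ℝ] ℝ}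
    (h : pull (k + 1) L f = e) {w : E} (hw : e.curryLeft w = 0) (v : Fin (k + 1) → E) :
    ‖L w‖ * |e v| ≤ ‖pull (k + 2) L‖ * ‖f‖ * ((k + 2) * ‖w‖ * ∏ i, ‖v i‖) := by
  obtain ⟨l, hl, hlw⟩ := exists_dual_vector'' ℝ (L w)
  let ω : E [⋀^Fin (k + 2)]→L[ℝ] ℝ :=
    alternatizeUncurryFin ((l : E →L[ℝ] ℝ).smulRight f)
  have hω : ‖ω‖ ≤ (k + 2) * ‖f‖ := by
    have h1 := norm_alternatizeUncurryFin_le ((l : E →L[ℝ] ℝ).smulRight f)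
    rw [ContinuousLinearMap.norm_smulRight_apply] at h1
    calc _ ≤ _ := h1
      _ ≤ (((k + 1 : ℕ) : ℝ) + 1) * (1 * ‖f‖) := by gcongr
      _ = _ := by push_cast; ring
  have hev : pull (k + 2) L ω (Fin.cons w v) = ‖L w‖ * e v := by
    rw [pull_apply]
    simp only [ω]
    rw [alternatizeUncurryFin_apply, Fin.sum_univ_succ]
    rw [Finset.sum_eq_zero, add_zero]
    · simp only [Fin.val_zero, pow_zero, one_smul, Fin.cons_zero,
        ContinuousLinearMap.smulRight_apply, ContinuousAlternatingMap.smul_apply, smul_eq_mul]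
      rw [hlw, ← h, pull_apply]
      rfl
    · intro i _
      have : f ((i.succ).removeNth fun j => L ((Fin.cons w v : Fin (k + 2) → E) j)) = 0 := by
        have h2 : e.curryLeft w (i.removeNth v) = 0 := by rw [hw]; rfl
        rw [curryLeft_apply_apply, ← h, pull_apply] at h2
        rw [← h2]
        congr 1
        funext j
        simp only [Fin.removeNth_apply]
        refine Fin.cases ?_ (fun j => ?_) j
        · simp [Matrix.vecCons]
        · simp [Matrix.vecCons, Fin.removeNth_apply]
      simp only [ContinuousLinearMap.smulRight_apply, ContinuousAlternatingMap.smul_apply]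
      rw [this]
      simp
  have h3 : |pull (k + 2) L ω (Fin.cons w v)| ≤
      ‖pull (k + 2) L ω‖ * ∏ i, ‖(Fin.cons w v : Fin (k + 2) → E) i‖ :=
    (pull (k + 2) L ω).le_opNorm _
  rw [hev, abs_mul, abs_norm, Fin.prod_univ_succ] at h3
  simp only [Fin.cons_zero, Fin.cons_succ] at h3
  have h4 := (pull (k + 2) L).le_opNorm ω
  have h5 : 0 ≤ ∏ i, ‖v i‖ := Finset.prod_nonneg fun i _ => norm_nonneg _
  calc _ ≤ _ := h3
    _ ≤ (‖pull (k + 2) L‖ * ((k + 2) * ‖f‖)) * (‖w‖ * ∏ i, ‖v i‖) := by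
        gcongr
        exact h4.trans (by gcongr)
    _ = _ := by ring

lemma continuous_norm_pull (k : ℕ) : Continuous fun L : E →L[ℝ] E => ‖pull k L‖ := by
  have h1 : Continuous fun L : E →L[ℝ] E => pull k L := continuous_compContinuousLinearMapCLM
  have h2 := continuous_norm (E := (E [⋀^Fin k]→L[ℝ] ℝ) →L[ℝ] (E [⋀^Fin k]→L[ℝ] ℝ))
  exact h2.comp h1

lemma measurable_pull {p k : ℕ} {α : Type*} [MeasurableSpace α]
    {A : α → (EuclideanSpace ℝ (Fin p) →L[ℝ] EuclideanSpace ℝ (Fin p))}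
    (hA : ∀ w, Measurable fun x => A x w) :
    (Measurable fun x => ‖A x‖) ∧ (Measurable fun x => ‖pull k (A x)‖) ∧
    ∀ f, Measurable fun x => ‖pull k (A x) f‖ := by
  let E := EuclideanSpace ℝ (Fin p)
  let b : Module.Basis (Fin p) ℝ E := (EuclideanSpace.basisFun (Fin p) ℝ).toBasis
  let φ : (Fin p → E) →ₗ[ℝ] (E →L[ℝ] E) :=
    (LinearMap.toContinuousLinearMap (𝕜 := ℝ) (E := E) (F' := E)).toLinearMap.comp
      (b.constr ℝ).toLinearMap
  have hφ : Continuous φ := LinearMap.continuous_of_finiteDimensional φ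
  have hAφ : ∀ x, A x = φ (fun i => A x (b i)) := by
    intro x
    apply ContinuousLinearMap.coe_injective
    apply b.ext
    intro i
    simp [φ]
  have hm : Measurable fun x => (fun i => A x (b i)) := measurable_pi_iff.2 fun i => hA (b i)
  refine ⟨?_, ?_, fun f => ?_⟩
  · have : (fun x => ‖A x‖) = (fun z => ‖φ z‖) ∘ fun x => (fun i => A x (b i)) := by
      funext x
      simp only [Function.comp]
      rw [← hAφ]
    rw [this]
    exact (hφ.norm).measurable.comp hm
  · have : (fun x => ‖pull k (A x)‖) = (fun z => ‖pull k (φ z)‖) ∘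
        fun x => (fun i => A x (b i)) := by
      funext x
      simp only [Function.comp]
      rw [← hAφ]
    rw [this]
    exact ((continuous_norm_pull k).comp hφ).measurable.comp hm
  · have : (fun x => ‖pull k (A x) f‖) = (fun z => ‖pull k (φ z) f‖) ∘
        fun x => (fun i => A x (b i)) := by
      funext x
      simp only [Function.comp]
      rw [← hAφ]
    rw [this]
    have h1 : Continuous fun z => pull k (φ z) f :=
      (continuous_compContinuousLinearMapCLM.comp hφ).clm_apply continuous_const
    exact h1.norm.measurable.comp hm

end Forms


lemma opNorm_pos_of_apply_ne {H : Type*} [NormedAddCommGroup H] [NormedSpace ℝ H]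
    {D : H →L[ℝ] H} {z : H} (h : D z ≠ 0) : 0 < ‖D‖ := by
  apply norm_pos_iff.2
  rintro rfl
  simp at h

section Cocycle

variable {α : Type*} {p : ℕ} {T : α → α}
  {A : α → (EuclideanSpace ℝ (Fin p) ≃L[ℝ] EuclideanSpace ℝ (Fin p))}

lemma cocycleIter_zero_apply (x : α) (w : EuclideanSpace ℝ (Fin p)) :
    cocycleIter T A 0 x w = w := rfl

lemma cocycleIter_succ_apply (n : ℕ) (x : α) (w : EuclideanSpace ℝ (Fin p)) :
    cocycleIter T A (n + 1) x w = cocycleIter T A n (T x) (A x w) := rfl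

lemma cocycleIter_add_apply (n m : ℕ) (x : α) (w : EuclideanSpace ℝ (Fin p)) :
    cocycleIter T A (n + m) x w = cocycleIter T A m (T^[n] x) (cocycleIter T A n x w) := by
  induction n generalizing x w with
  | zero => simp [cocycleIter_zero_apply]
  | succ n ih =>
    rw [show n + 1 + m = n + m + 1 by ring, cocycleIter_succ_apply, ih,
      cocycleIter_succ_apply, Function.iterate_succ_apply]

lemma cocycleIter_succ_apply' (n : ℕ) (x : α) (w : EuclideanSpace ℝ (Fin p)) :
    cocycleIter T A (n + 1) x w = A (T^[n] x) (cocycleIter T A n x w) := by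
  rw [cocycleIter_add_apply]; rfl

lemma cocycleIter_measurable [MeasurableSpace α] (hTm : Measurable T)
    (hA : ∀ w, Measurable fun x => A x w) (n : ℕ) (w : EuclideanSpace ℝ (Fin p)) :
    Measurable fun x => cocycleIter T A n x w := by
  induction n with
  | zero => exact measurable_const
  | succ n ih =>
    simp_rw [cocycleIter_succ_apply']
    have h1 : ∀ (y : α) (z : EuclideanSpace ℝ (Fin p)),
        A y z = ∑ i, z i • A y (EuclideanSpace.basisFun (Fin p) ℝ i) := by
      intro y z
      conv_lhs => rw [← (EuclideanSpace.basisFun (Fin p) ℝ).sum_repr z]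
      rw [map_sum]
      simp
    have h2 : (fun x => A (T^[n] x) (cocycleIter T A n x w)) = fun x =>
        ∑ i, (cocycleIter T A n x w) i • A (T^[n] x) (EuclideanSpace.basisFun (Fin p) ℝ i) := by
      funext x; exact h1 _ _
    rw [h2]
    refine Finset.measurable_sum _ fun i _ => ?_
    have h3 : Continuous fun z : EuclideanSpace ℝ (Fin p) => z i := by fun_prop
    have h4 : Measurable fun x => (cocycleIter T A n x w) i := h3.measurable.comp ih
    have h5 : Measurable fun x => A (T^[n] x) (EuclideanSpace.basisFun (Fin p) ℝ i) :=
      (hA _).comp (hTm.iterate n)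
    exact h4.smul h5

/-- The cocycle induced on alternating forms. -/
noncomputable def formCocycle (T : α → α)
    (A : α → (EuclideanSpace ℝ (Fin p) ≃L[ℝ] EuclideanSpace ℝ (Fin p))) (k n : ℕ) (x : α) :
    (EuclideanSpace ℝ (Fin p) [⋀^Fin k]→L[ℝ] ℝ) →L[ℝ]
      (EuclideanSpace ℝ (Fin p) [⋀^Fin k]→L[ℝ] ℝ) :=
  pull k (cocycleIter T A n x : EuclideanSpace ℝ (Fin p) →L[ℝ] EuclideanSpace ℝ (Fin p))

lemma formCocycle_zero (k : ℕ) (x : α) :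
    formCocycle T A k 0 x = ContinuousLinearMap.id ℝ _ := by
  rw [← pull_id]
  rfl

lemma formCocycle_add (k n m : ℕ) (x : α) :
    formCocycle T A k (n + m) x = (formCocycle T A k n x).comp (formCocycle T A k m (T^[n] x)) := by
  unfold formCocycle
  rw [← pull_comp]
  congr 1
  ext1 w
  exact cocycleIter_add_apply n m x w

lemma formCocycle_injective (k n : ℕ) (x : α) : Function.Injective (formCocycle T A k n x) :=
  pull_injective k (cocycleIter T A n x)

/-- Exponential growth bounds for the cocycle on `k`-forms. -/
def Gr [MeasurableSpace α] (μ : Measure α) (T : α → α)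
    (A : α → (EuclideanSpace ℝ (Fin p) ≃L[ℝ] EuclideanSpace ℝ (Fin p))) (k : ℕ) (c : ℝ) : Prop :=
  ∀ᵐ x ∂μ, ∃ C : ℝ, ∀ n : ℕ, ‖formCocycle T A k n x‖ ≤ C * Real.exp (c * n)

variable [MeasurableSpace α] {μ : Measure α} [IsProbabilityMeasure μ]

lemma Gr_of_subsingleton {k : ℕ}
    (h : ∀ f : EuclideanSpace ℝ (Fin p) [⋀^Fin k]→L[ℝ] ℝ, f = 0) (c : ℝ) : Gr μ T A k c := by
  filter_upwards with x
  refine ⟨0, fun n => ?_⟩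
  have : formCocycle T A k n x = 0 := by ext1 f; exact h _
  rw [this, ContinuousLinearMap.opNorm_zero]; simp

lemma Gr_or (hT : Ergodic T μ) (hA : ∀ w, Measurable fun x => A x w)
    (hint : Integrable (fun x =>
      Real.log ‖(A x : EuclideanSpace ℝ (Fin p) →L[ℝ] EuclideanSpace ℝ (Fin p))‖) μ)
    (k : ℕ) [Nontrivial (EuclideanSpace ℝ (Fin p) [⋀^Fin k]→L[ℝ] ℝ)] (c : ℝ)
    {n : ℕ} (hn : 1 ≤ n)
    (H : ¬ (Integrable (fun x => Real.log ‖formCocycle T A k n x‖) μ ∧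
      c * n ≤ ∫ x, Real.log ‖formCocycle T A k n x‖ ∂μ)) : Gr μ T A k c := by
  have hpos : ∀ n x, 0 < ‖formCocycle T A k n x‖ := by
    intro n x
    obtain ⟨z, hz⟩ := exists_ne (0 : EuclideanSpace ℝ (Fin p) [⋀^Fin k]→L[ℝ] ℝ)
    have h1 : formCocycle T A k n x z ≠ 0 :=
      fun h0 => hz (formCocycle_injective k n x (by rw [h0, map_zero]))
    exact opNorm_pos_of_apply_ne h1
  have hAm := (measurable_pull (k := k)
    (A := fun x => (A x : EuclideanSpace ℝ (Fin p) →L[ℝ] EuclideanSpace ℝ (Fin p))) hA).1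
  have hk := kingman_upper hT (a := fun n x => Real.log ‖formCocycle T A k n x‖)
    (fun n => Real.measurable_log.comp (measurable_pull
      (A := fun x => (cocycleIter T A n x :
        EuclideanSpace ℝ (Fin p) →L[ℝ] EuclideanSpace ℝ (Fin p)))
      (cocycleIter_measurable hT.measurable hA n)).2.1)
    (fun n m x => by
      have h1 : ‖formCocycle T A k (n + m) x‖ ≤
          ‖formCocycle T A k n x‖ * ‖formCocycle T A k m (T^[n] x)‖ := by
        rw [formCocycle_add]; exact ContinuousLinearMap.opNorm_comp_le _ _
      have h2 := Real.log_le_log (hpos _ _) h1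
      rwa [Real.log_mul (hpos _ _).ne' (hpos _ _).ne'] at h2)
    (fun x => by
      simp only [formCocycle_zero]
      exact Real.log_nonpos (ContinuousLinearMap.opNorm_nonneg _) ContinuousLinearMap.norm_id_le)
    (h := fun x => k * |Real.log
      ‖(A x : EuclideanSpace ℝ (Fin p) →L[ℝ] EuclideanSpace ℝ (Fin p))‖|)
    ((Real.measurable_log.comp hAm).abs.const_mul _)
    (hint.abs.const_mul _) (fun x => by positivity)
    (fun x => by
      have h1 : ‖formCocycle T A k 1 x‖ ≤
          ‖(A x : EuclideanSpace ℝ (Fin p) →L[ℝ] EuclideanSpace ℝ (Fin p))‖ ^ k :=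
        norm_pull_le k _
      have h2 := Real.log_le_log (hpos _ _) h1
      rw [Real.log_pow] at h2
      refine h2.trans ?_
      gcongr
      exact le_abs_self _) hn H
  filter_upwards [hk] with x hx
  obtain ⟨C, hC⟩ := hx
  refine ⟨Real.exp C, fun N => ?_⟩
  have := hC N
  rw [Real.log_le_iff_le_exp (hpos _ _)] at this
  rwa [← Real.exp_add, add_comm]

lemma Gr_mono {k : ℕ} {c d : ℝ} (hcd : c ≤ d) (h : Gr μ T A k c) : Gr μ T A k d := by
  filter_upwards [h] with x ⟨C, hC⟩
  refine ⟨C, fun n => (hC n).trans ?_⟩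
  have h0 : 0 ≤ C := by
    have := (ContinuousLinearMap.opNorm_nonneg _).trans (hC 0)
    simpa using this
  gcongr

lemma Gr_exists (hT : Ergodic T μ) (hA : ∀ w, Measurable fun x => A x w)
    (hint : Integrable (fun x =>
      Real.log ‖(A x : EuclideanSpace ℝ (Fin p) →L[ℝ] EuclideanSpace ℝ (Fin p))‖) μ)
    (k : ℕ) : ∃ c, Gr μ T A k c := by
  by_cases h : Nontrivial (EuclideanSpace ℝ (Fin p) [⋀^Fin k]→L[ℝ] ℝ)
  · refine ⟨∫ x, Real.log ‖formCocycle T A k 1 x‖ ∂μ + 1, Gr_or hT hA hint k _ le_rfl ?_⟩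
    rintro ⟨-, h2⟩
    simp at h2
    linarith
  · rw [not_nontrivial_iff_subsingleton] at h
    exact ⟨0, Gr_of_subsingleton (fun f => Subsingleton.elim _ _) 0⟩

lemma Gr_zero : Gr μ T A 0 0 := by
  filter_upwards with x
  refine ⟨1, fun n => ?_⟩
  have := norm_pull_le 0
    (cocycleIter T A n x : EuclideanSpace ℝ (Fin p) →L[ℝ] EuclideanSpace ℝ (Fin p))
  simpa [formCocycle] using this

lemma not_Gr_zero {c : ℝ} (hc : c < 0) : ¬ Gr μ T A 0 c := by
  intro h
  obtain ⟨x, C, hC⟩ := h.exists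
  have hid : ∀ n : ℕ, (1 : ℝ) ≤ C * Real.exp (c * n) := by
    intro n
    refine le_trans ?_ (hC n)
    have h1 := (formCocycle T A 0 n x).le_opNorm
      (ContinuousAlternatingMap.constOfIsEmpty ℝ (EuclideanSpace ℝ (Fin p)) (Fin 0) (1 : ℝ))
    have h2 : formCocycle T A 0 n x
      (ContinuousAlternatingMap.constOfIsEmpty ℝ (EuclideanSpace ℝ (Fin p)) (Fin 0) (1 : ℝ)) =
      (ContinuousAlternatingMap.constOfIsEmpty ℝ (EuclideanSpace ℝ (Fin p)) (Fin 0) (1 : ℝ)) := by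
      ext v; rfl
    rw [h2] at h1
    simp at h1
    exact h1
  have hlim : Tendsto (fun n : ℕ => C * Real.exp (c * n)) atTop (nhds (C * 0)) := by
    apply Tendsto.const_mul
    apply Real.tendsto_exp_atBot.comp
    exact Tendsto.const_mul_atTop_of_neg hc tendsto_natCast_atTop_atTop
  have := ge_of_tendsto' hlim hid
  simp at this
  linarith

end Cocycle

lemma choose_degree (G : ℕ → ℝ → Prop) (p : ℕ) (hmono : ∀ k c d, c ≤ d → G k c → G k d)
    (hex : ∀ k, ∃ c, G k c) (h0 : G 0 0) (h0' : ∀ c < 0, ¬ G 0 c)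
    (hp : ∀ k > p, ∀ c, G k c) :
    (∀ ε > 0, G 1 ε) ∨ ∃ (k : ℕ) (L L' : ℝ), L' < L ∧ G k L' ∧
      ∀ ε > 0, ¬ G (k + 1) (L - ε) ∧ G (k + 2) (L + ε) := by
  classical
  let Λ : ℕ → EReal := fun k => sInf ((fun c : ℝ => (c : EReal)) '' {c | G k c})
  have h1 : ∀ k (c : ℝ), Λ k < c → G k c := by
    intro k c hc
    obtain ⟨_, ⟨d, hd, rfl⟩, hdc⟩ := sInf_lt_iff.1 hc
    exact hmono k d c (EReal.coe_le_coe_iff.1 hdc.le) hd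
  have h2 : ∀ k (c : ℝ), G k c → Λ k ≤ c := fun k c hc => sInf_le ⟨c, hc, rfl⟩
  have hmax : ∃ k, ∀ j, Λ j ≤ Λ k := by
    obtain ⟨k, -, hk⟩ := Finset.exists_max_image (Finset.range (p + 1)) Λ ⟨0, by simp⟩
    refine ⟨k, fun j => ?_⟩
    by_cases hj : j < p + 1
    · exact hk j (Finset.mem_range.2 hj)
    · have : Λ j = ⊥ := by
        rw [EReal.eq_bot_iff_forall_lt]
        intro c
        refine lt_of_le_of_lt (h2 j (c - 1) (hp j (by omega) _)) ?_
        exact_mod_cast sub_one_lt c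
      rw [this]; exact bot_le
  have hΛ0 : Λ 0 ≤ 0 := by exact_mod_cast h2 0 0 h0
  have hΛ0' : 0 ≤ Λ 0 := by
    by_contra hlt
    push Not at hlt
    obtain ⟨c, hc1, hc2⟩ := EReal.lt_iff_exists_real_btwn.1 hlt
    exact h0' c (by exact_mod_cast hc2) (h1 0 c hc1)
  obtain ⟨hk, hkmin⟩ := And.intro (Nat.find_spec hmax) (fun {m} => Nat.find_min hmax (m := m))
  set k := Nat.find hmax with hkdef
  rcases Nat.eq_zero_or_pos k with hk0 | hkpos
  · left
    intro ε hε
    apply h1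
    refine lt_of_le_of_lt (hk 1) ?_
    rw [hk0]
    exact lt_of_le_of_lt hΛ0 (by exact_mod_cast hε)
  · right
    obtain ⟨j, hj⟩ : ∃ j, k = j + 1 := ⟨k - 1, by omega⟩
    have hlt : Λ j < Λ k := by
      have := hkmin (m := j) (by omega)
      push Not at this
      obtain ⟨i, hi⟩ := this
      exact lt_of_lt_of_le hi (hk i)
    obtain ⟨c0, hc0⟩ := hex k
    have htop : Λ k ≠ ⊤ := ne_of_lt (lt_of_le_of_lt (h2 k c0 hc0) (EReal.coe_lt_top c0))
    have hbot : Λ k ≠ ⊥ := by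
      intro h
      rw [h] at hlt
      exact not_lt_bot hlt
    obtain ⟨L, hL⟩ : ∃ L : ℝ, Λ k = L := ⟨(Λ k).toReal, (EReal.coe_toReal htop hbot).symm⟩
    obtain ⟨L', hL1, hL2⟩ := EReal.lt_iff_exists_real_btwn.1 hlt
    rw [hL] at hL2
    refine ⟨j, L, L', by exact_mod_cast hL2, h1 j L' hL1, fun ε hε => ⟨fun hG => ?_, ?_⟩⟩
    · have := h2 _ _ hG
      rw [← hj, hL] at this
      have : L ≤ L - ε := by exact_mod_cast this
      linarith
    · apply h1
      refine lt_of_le_of_lt (hk _) ?_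
      rw [hL]
      have : L < L + ε := by linarith
      exact_mod_cast this


lemma ae_exists_iterate_mem {α : Type*} [MeasurableSpace α] {μ : Measure α}
    [IsProbabilityMeasure μ] {T : α → α} (hT : Ergodic T μ) {G : Set α} (hG : MeasurableSet G)
    (hG0 : μ G ≠ 0) : ∀ᵐ x ∂μ, ∃ n : ℕ, T^[n] x ∈ G := by
  let W : Set α := ⋃ n : ℕ, T^[n] ⁻¹' G
  have hW : MeasurableSet W := MeasurableSet.iUnion fun n => (hT.measurable.iterate n) hG
  have hsub : T ⁻¹' W ⊆ W := by
    intro x hx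
    obtain ⟨n, hn⟩ := Set.mem_iUnion.1 hx
    refine Set.mem_iUnion.2 ⟨n + 1, ?_⟩
    simpa [Function.iterate_succ_apply] using hn
  have hGW : G ⊆ W := fun x hx => Set.mem_iUnion.2 ⟨0, hx⟩
  rcases hT.ae_empty_or_univ_of_preimage_ae_le hW.nullMeasurableSet
    (Eventually.of_forall hsub) with h | h
  · exfalso
    apply hG0
    have : μ W = 0 := by rw [measure_congr h]; simp
    exact measure_mono_null hGW this
  · have h2 : ∀ᵐ x ∂μ, x ∈ W := eventuallyEq_univ.1 h
    filter_upwards [h2] with x hx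
    exact Set.mem_iUnion.1 hx

lemma ae_forall_iterate {α : Type*} [MeasurableSpace α] {μ : Measure α}
    {T : α → α} (hT : MeasurePreserving T μ μ) {P : α → Prop} (hP : ∀ᵐ x ∂μ, P x) :
    ∀ᵐ x ∂μ, ∀ n : ℕ, P (T^[n] x) := by
  rw [ae_all_iff]
  intro n
  exact (hT.iterate n).quasiMeasurePreserving.ae hP

lemma not_exp_le_of_lt {r s C d : ℝ} (hd : 0 < d) (hrs : s < r)
    (h : ∀ n : ℕ, Real.exp (r * n) * d ≤ C * Real.exp (s * n)) : False := by
  have h1 : ∀ n : ℕ, Real.exp ((r - s) * n) ≤ C / d := by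
    intro n
    rw [le_div_iff₀ hd]
    have := h n
    have e : Real.exp (r * n) = Real.exp ((r - s) * n) * Real.exp (s * n) := by
      rw [← Real.exp_add]; ring_nf
    rw [e] at this
    have hp := Real.exp_pos (s * n)
    nlinarith
  have hlim : Tendsto (fun n : ℕ => Real.exp ((r - s) * n)) atTop atTop :=
    Real.tendsto_exp_atTop.comp
      (tendsto_natCast_atTop_atTop.const_mul_atTop (by linarith))
  obtain ⟨n, hn⟩ := (hlim.eventually_gt_atTop (C / d)).exists
  linarith [h1 n]

lemma norm_le_pull_one {E : Type*} [NormedAddCommGroup E] [NormedSpace ℝ E] (L : E →L[ℝ] E)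
    (w : E) : ‖L w‖ ≤ ‖pull 1 L‖ * ‖w‖ := by
  obtain ⟨l, hl, hlw⟩ := exists_dual_vector'' ℝ (L w)
  let ω : E [⋀^Fin 1]→L[ℝ] ℝ := ContinuousAlternatingMap.ofSubsingleton ℝ E ℝ (0 : Fin 1) l
  have hω : ‖ω‖ ≤ 1 := by
    refine le_trans (le_of_eq ?_) hl
    exact ContinuousAlternatingMap.norm_ofSubsingleton _ l
  have h1 : |pull 1 L ω (fun _ => w)| ≤ ‖pull 1 L ω‖ * ∏ _i : Fin 1, ‖w‖ :=
    (pull 1 L ω).le_opNorm _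
  have h2 : pull 1 L ω (fun _ => w) = ‖L w‖ := hlw
  rw [h2, abs_norm] at h1
  have h3 := (pull 1 L).le_opNorm ω
  simp at h1
  calc _ ≤ _ := h1
    _ ≤ (‖pull 1 L‖ * 1) * ‖w‖ := by
      gcongr
      exact h3.trans (mul_le_mul_of_nonneg_left hω (ContinuousLinearMap.opNorm_nonneg _))
    _ = _ := by ring

section Separation

variable {α : Type*} {p : ℕ} {T : α → α}
  {A : α → (EuclideanSpace ℝ (Fin p) ≃L[ℝ] EuclideanSpace ℝ (Fin p))}

/-- `q` separates fast directions from directions growing at rate at most `s`. -/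
def CocSep (T : α → α) (A : α → (EuclideanSpace ℝ (Fin p) ≃L[ℝ] EuclideanSpace ℝ (Fin p)))
    (k : ℕ) (r s : ℝ) (x : α) : Prop :=
  ∃ q : EuclideanSpace ℝ (Fin p) →L[ℝ] (EuclideanSpace ℝ (Fin p) [⋀^Fin k]→L[ℝ] ℝ),
    (∀ (n : ℕ) w, Real.exp (r * n) * ‖q w‖ ≤ ‖cocycleIter T A n x w‖) ∧
    ∀ w, q w = 0 → ∃ C : ℝ, ∀ n : ℕ, ‖cocycleIter T A n x w‖ ≤ C * Real.exp (s * n)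

lemma CocSep_of_image {k : ℕ} {r s : ℝ} {x : α} (h : CocSep T A k r s (T x)) : CocSep T A k r s x := by
  obtain ⟨q, hq1, hq2⟩ := h
  set Q := q.comp (A x : EuclideanSpace ℝ (Fin p) →L[ℝ] EuclideanSpace ℝ (Fin p)) with hQ
  have hQn : 0 ≤ ‖Q‖ := ContinuousLinearMap.opNorm_nonneg _
  set t := min (Real.exp (-r)) (1 / (1 + ‖Q‖)) with ht
  have htpos : 0 < t := lt_min (Real.exp_pos _) (by positivity)
  have hn : ∀ w, ‖(t • Q) w‖ = t * ‖q (A x w)‖ := by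
    intro w
    have : (t • Q) w = t • q (A x w) := rfl
    rw [this, norm_smul, Real.norm_of_nonneg htpos.le]
  refine ⟨t • Q, fun n w => ?_, fun w hw => ?_⟩
  · rw [hn]
    cases n with
    | zero =>
      have h1 : ‖q (A x w)‖ ≤ ‖Q‖ * ‖w‖ := Q.le_opNorm w
      have h2 : t * (1 + ‖Q‖) ≤ 1 := by
        have : t ≤ 1 / (1 + ‖Q‖) := min_le_right _ _
        rwa [le_div_iff₀ (by positivity)] at this
      simp only [Nat.cast_zero, mul_zero, Real.exp_zero, one_mul, cocycleIter_zero_apply]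
      calc t * ‖q (A x w)‖ ≤ t * (‖Q‖ * ‖w‖) := by gcongr
        _ ≤ (t * (1 + ‖Q‖)) * ‖w‖ := by nlinarith [mul_nonneg htpos.le (norm_nonneg w)]
        _ ≤ 1 * ‖w‖ := by gcongr
        _ = ‖w‖ := one_mul _
    | succ n =>
      rw [cocycleIter_succ_apply]
      refine le_trans ?_ (hq1 n (A x w))
      have h1 : t ≤ Real.exp (-r) := min_le_left _ _
      have h2 : Real.exp (r * n) = Real.exp (r * (n + 1 : ℕ)) * Real.exp (-r) := by
        rw [← Real.exp_add]; push_cast; ring_nf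
      rw [h2, mul_assoc]
      gcongr
  · have hw' : q (A x w) = 0 := by
      have h1 := hn w
      rw [hw, norm_zero] at h1
      have : ‖q (A x w)‖ = 0 := by
        rcases mul_eq_zero.1 h1.symm with h | h
        · exact absurd h htpos.ne'
        · exact h
      exact norm_eq_zero.1 this
    obtain ⟨C, hC⟩ := hq2 _ hw'
    refine ⟨max ‖w‖ (C * Real.exp (-s)), fun n => ?_⟩
    cases n with
    | zero => simp [cocycleIter_zero_apply]
    | succ n =>
      rw [cocycleIter_succ_apply]
      refine (hC n).trans ?_
      have h2 : Real.exp (s * n) = Real.exp (-s) * Real.exp (s * (n + 1 : ℕ)) := by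
        rw [← Real.exp_add]; push_cast; ring_nf
      rw [h2, ← mul_assoc]
      gcongr
      exact le_max_right _ _

lemma CocSep_of_iterate {k : ℕ} {r s : ℝ} (n : ℕ) : ∀ {x : α}, CocSep T A k r s (T^[n] x) →
    CocSep T A k r s x := by
  induction n with
  | zero => intro x h; exact h
  | succ n ih =>
    intro x h
    rw [Function.iterate_succ_apply] at h
    exact CocSep_of_image (ih h)

lemma CocSep_of_forms {k : ℕ} {L L' ε r : ℝ} (hr : r ≤ L - L' - 2 * ε) {x : α}
    (hg1 : ∃ C : ℝ, ∀ n : ℕ, ‖formCocycle T A k n x‖ ≤ C * Real.exp (L' * n))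
    (hg2 : ∃ C : ℝ, ∀ n : ℕ, ‖formCocycle T A (k + 2) n x‖ ≤ C * Real.exp ((L + ε) * n))
    (he : ∃ e : EuclideanSpace ℝ (Fin p) [⋀^Fin (k + 1)]→L[ℝ] ℝ, ‖e‖ = 1 ∧
      ∀ j : ℕ, ∃ f, formCocycle T A (k + 1) j x f = e ∧ ‖f‖ ≤ Real.exp (-((L - 2 * ε) * j))) :
    CocSep T A k r (3 * ε) x := by
  obtain ⟨C1, hC1⟩ := hg1
  obtain ⟨C2, hC2⟩ := hg2
  obtain ⟨e, he1, he2⟩ := he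
  have hC1n : 0 ≤ C1 := by
    have := (ContinuousLinearMap.opNorm_nonneg _).trans (hC1 0)
    simpa using this
  have hC2n : 0 ≤ C2 := by
    have := (ContinuousLinearMap.opNorm_nonneg _).trans (hC2 0)
    simpa using this
  have hC1p : 0 < C1 + 1 := by linarith
  have hbound : ∀ (n : ℕ) w, Real.exp (r * n) * ‖e.curryLeft w‖ ≤
      C1 * ‖cocycleIter T A n x w‖ := by
    intro n w
    obtain ⟨f, hf, hf'⟩ := he2 n
    have h1 := forms_ii hf w
    have h2 : ‖e.curryLeft w‖ ≤ (C1 * Real.exp (L' * n)) * Real.exp (-((L - 2 * ε) * n)) *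
        ‖cocycleIter T A n x w‖ := by
      refine h1.trans ?_
      have := hC1 n
      unfold formCocycle at this
      have h3 : (0 : ℝ) ≤ ‖f‖ := norm_nonneg f
      refine mul_le_mul_of_nonneg_right ?_ (norm_nonneg _)
      exact mul_le_mul this hf' h3 (by positivity)
    calc Real.exp (r * n) * ‖e.curryLeft w‖
        ≤ Real.exp (r * n) * ((C1 * Real.exp (L' * n)) * Real.exp (-((L - 2 * ε) * n)) *
        ‖cocycleIter T A n x w‖) := by gcongr
      _ = Real.exp (r * n + L' * n + -((L - 2 * ε) * n)) *
          (C1 * ‖cocycleIter T A n x w‖) := by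
          rw [Real.exp_add, Real.exp_add]; ring
      _ ≤ 1 * (C1 * ‖cocycleIter T A n x w‖) := by
          gcongr
          rw [Real.exp_le_one_iff]
          have : (0 : ℝ) ≤ n := Nat.cast_nonneg n
          nlinarith
      _ = _ := one_mul _
  have hn : ∀ w, ‖((C1 + 1)⁻¹ • e.curryLeft) w‖ = (C1 + 1)⁻¹ * ‖e.curryLeft w‖ := by
    intro w
    have : ((C1 + 1)⁻¹ • e.curryLeft) w = (C1 + 1)⁻¹ • (e.curryLeft w) := rfl
    rw [this, norm_smul, Real.norm_of_nonneg (by positivity)]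
  refine ⟨(C1 + 1)⁻¹ • e.curryLeft, fun n w => ?_, fun w hw => ?_⟩
  · rw [hn]
    have h1 := hbound n w
    have h2 := norm_nonneg (cocycleIter T A n x w)
    rw [show Real.exp (r * n) * ((C1 + 1)⁻¹ * ‖e.curryLeft w‖) =
      (C1 + 1)⁻¹ * (Real.exp (r * n) * ‖e.curryLeft w‖) by ring, inv_mul_le_iff₀ hC1p]
    linarith
  · have hw' : e.curryLeft w = 0 := by
      have h1 := hn w
      rw [hw, norm_zero] at h1
      have : ‖e.curryLeft w‖ = 0 := by
        rcases mul_eq_zero.1 h1.symm with h | h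
        · exact absurd h (inv_pos.2 hC1p).ne'
        · exact h
      exact norm_eq_zero.1 this
    obtain ⟨v, hv⟩ : ∃ v, e v ≠ 0 := by
      by_contra hcon
      push Not at hcon
      have : e = 0 := by ext v; exact hcon v
      rw [this, norm_zero] at he1
      exact zero_ne_one he1
    have hvp : 0 < |e v| := abs_pos.2 hv
    set K := ((k : ℝ) + 2) * ‖w‖ * ∏ i, ‖v i‖ with hK
    have hK0 : 0 ≤ K := by positivity
    refine ⟨C2 * K / |e v|, fun n => ?_⟩
    obtain ⟨f, hf, hf'⟩ := he2 n
    have h1 := forms_i hf hw' v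
    have h2 := hC2 n
    unfold formCocycle at h2
    have h3 : (0 : ℝ) ≤ ‖f‖ := norm_nonneg f
    have h4 : ‖cocycleIter T A n x w‖ * |e v| ≤
        (C2 * Real.exp ((L + ε) * n)) * Real.exp (-((L - 2 * ε) * n)) * K := by
      refine h1.trans ?_
      exact mul_le_mul_of_nonneg_right (mul_le_mul h2 hf' h3 (by positivity)) hK0
    have h5 : (C2 * Real.exp ((L + ε) * n)) * Real.exp (-((L - 2 * ε) * n)) * K =
        C2 * K * Real.exp (3 * ε * n) := by
      rw [mul_assoc C2, ← Real.exp_add]; ring_nf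
    rw [h5] at h4
    rw [div_mul_eq_mul_div, le_div_iff₀ hvp]
    exact h4

variable [MeasurableSpace α] {μ : Measure α} [IsProbabilityMeasure μ]

lemma ae_Sep (hT : Ergodic T μ) (hA : ∀ w, Measurable fun x => A x w)
    (hint : Integrable (fun x =>
      Real.log ‖(A x : EuclideanSpace ℝ (Fin p) →L[ℝ] EuclideanSpace ℝ (Fin p))‖) μ)
    {k : ℕ} {L L' ε r : ℝ} (hε : 0 < ε) (hr : r ≤ L - L' - 2 * ε) (h1 : Gr μ T A k L')
    (h2 : ¬ Gr μ T A (k + 1) (L - ε)) (h3 : Gr μ T A (k + 2) (L + ε)) :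
    ∀ᵐ x ∂μ, CocSep T A k r (3 * ε) x := by
  have hnt : Nontrivial (EuclideanSpace ℝ (Fin p) [⋀^Fin (k + 1)]→L[ℝ] ℝ) := by
    by_contra h
    rw [not_nontrivial_iff_subsingleton] at h
    exact h2 (Gr_of_subsingleton (fun f => Subsingleton.elim _ _) _)
  have hfd := forms_finiteDimensional (E := EuclideanSpace ℝ (Fin p)) (k + 1)
  obtain ⟨G, hGm, hG0, hG⟩ := pliss (D := formCocycle T A (k + 1)) hT.toMeasurePreserving
    (formCocycle_zero (k + 1)) (formCocycle_add (k + 1)) (formCocycle_injective (k + 1))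
    (fun n z => (measurable_pull (A := fun x => (cocycleIter T A n x :
        EuclideanSpace ℝ (Fin p) →L[ℝ] EuclideanSpace ℝ (Fin p)))
      (cocycleIter_measurable hT.measurable hA n)).2.2 z)
    (c := L - ε) (c' := L - 2 * ε) (by linarith)
    (fun n hn => by
      by_contra hcon
      exact h2 (Gr_or hT hA hint (k + 1) _ hn hcon))
  filter_upwards [ae_exists_iterate_mem hT hGm hG0, ae_forall_iterate hT.toMeasurePreserving h1,
    ae_forall_iterate hT.toMeasurePreserving h3] with x ⟨n, hn⟩ hx1 hx3
  exact CocSep_of_iterate n (CocSep_of_forms hr (hx1 n) (hx3 n) (hG _ hn))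

/-- The form of the Oseledets theorem that we need. -/
lemma separation (hT : Ergodic T μ) (hA : ∀ w, Measurable fun x => A x w)
    (hint : Integrable (fun x =>
      Real.log ‖(A x : EuclideanSpace ℝ (Fin p) →L[ℝ] EuclideanSpace ℝ (Fin p))‖) μ) :
    ∃ (k : ℕ) (r : ℝ), 0 < r ∧ ∀ᵐ x ∂μ, ∃ q : EuclideanSpace ℝ (Fin p) →L[ℝ]
        (EuclideanSpace ℝ (Fin p) [⋀^Fin k]→L[ℝ] ℝ),
      (∀ (n : ℕ) w, Real.exp (r * n) * ‖q w‖ ≤ ‖cocycleIter T A n x w‖) ∧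
      ∀ w, q w = 0 → ∀ s > 0, ∃ C : ℝ, ∀ n : ℕ,
        ‖cocycleIter T A n x w‖ ≤ C * Real.exp (s * n) := by
  rcases choose_degree (Gr μ T A) p (fun k c d => Gr_mono) (Gr_exists hT hA hint) Gr_zero
    (fun c hc => not_Gr_zero hc) (fun k hk c => Gr_of_subsingleton
      (fun f => forms_trivial (by simpa using hk) f) c) with h | ⟨k, L, L', hL, h1, h2⟩
  · refine ⟨0, 1, one_pos, ?_⟩
    have h' : ∀ᵐ x ∂μ, ∀ l : ℕ, ∃ C : ℝ, ∀ n : ℕ, ‖formCocycle T A 1 n x‖ ≤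
        C * Real.exp ((1 / ((l : ℝ) + 1)) * n) :=
      ae_all_iff.2 fun l => h _ (by positivity)
    filter_upwards [h'] with x hx
    refine ⟨0, fun n w => ?_, fun w _ s hs => ?_⟩
    · simp
    · obtain ⟨l, hl⟩ := exists_nat_one_div_lt hs
      obtain ⟨C, hC⟩ := hx l
      have hCn : 0 ≤ C := by
        have := (ContinuousLinearMap.opNorm_nonneg _).trans (hC 0)
        simpa using this
      refine ⟨C * ‖w‖, fun n => ?_⟩
      have h1 := norm_le_pull_one (cocycleIter T A n x :
        EuclideanSpace ℝ (Fin p) →L[ℝ] EuclideanSpace ℝ (Fin p)) w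
      have h2 := hC n
      unfold formCocycle at h2
      calc ‖cocycleIter T A n x w‖ ≤ _ := h1
        _ ≤ (C * Real.exp ((1 / ((l : ℝ) + 1)) * n)) * ‖w‖ :=
          mul_le_mul_of_nonneg_right h2 (norm_nonneg _)
        _ ≤ (C * Real.exp (s * n)) * ‖w‖ := by gcongr
        _ = _ := by ring
  · set r := (L - L') / 2 with hr
    have hrpos : 0 < r := by rw [hr]; linarith
    refine ⟨k, r, hrpos, ?_⟩
    have hall : ∀ᵐ x ∂μ, ∀ l : ℕ, CocSep T A k r (3 * (r / (4 * ((l : ℝ) + 1)))) x := by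
      refine ae_all_iff.2 fun l => ?_
      have hε : 0 < r / (4 * ((l : ℝ) + 1)) := by positivity
      have hε' : r / (4 * ((l : ℝ) + 1)) ≤ r / 4 := by
        apply div_le_div_of_nonneg_left hrpos.le (by norm_num)
        have : (0 : ℝ) ≤ l := Nat.cast_nonneg l
        linarith
      exact ae_Sep hT hA hint hε (by linarith) h1 (h2 _ hε).1 (h2 _ hε).2
    filter_upwards [hall] with x hx
    obtain ⟨q, hq1, hq2⟩ := hx 0
    refine ⟨q, hq1, fun w hw s hs => ?_⟩
    obtain ⟨C, hC⟩ := hq2 w hw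
    have hall : ∀ l : ℕ, ∃ C : ℝ, ∀ n : ℕ, ‖cocycleIter T A n x w‖ ≤
        C * Real.exp (3 * (r / (4 * ((l : ℝ) + 1))) * n) := by
      intro l
      obtain ⟨q', hq1', hq2'⟩ := hx l
      apply hq2'
      by_contra hne
      have hp : 0 < ‖q' w‖ := norm_pos_iff.2 hne
      refine not_exp_le_of_lt (C := C) hp (?_ : 3 * (r / (4 * (((0 : ℕ) : ℝ) + 1))) < r)
        (fun n => (hq1' n w).trans (hC n))
      simp
      linarith
    obtain ⟨l, hl⟩ := exists_nat_one_div_lt (show (0 : ℝ) < s / r by positivity)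
    obtain ⟨C', hC'⟩ := hall l
    refine ⟨C', fun n => (hC' n).trans ?_⟩
    have hCn : 0 ≤ C' := by
      have := (norm_nonneg _).trans (hC' 0)
      simpa using this
    have hls : 3 * (r / (4 * ((l : ℝ) + 1))) ≤ s := by
      rw [lt_div_iff₀ hrpos] at hl
      have : 3 * (r / (4 * ((l : ℝ) + 1))) = (3 / 4) * (1 / ((l : ℝ) + 1) * r) := by
        field_simp
      rw [this]
      linarith
    gcongr

end Separation

lemma telescope_le {z : ℕ → ℝ} (hz : Monotone z) (n M : ℕ) :
    ∑ i ∈ Finset.range M, (z (i + n) - z i) ≤ n * (z (M + n) - z 0) := by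
  have h1 : ∑ i ∈ Finset.range (M + n), z i =
      ∑ i ∈ Finset.range M, z i + ∑ i ∈ Finset.range n, z (M + i) := Finset.sum_range_add _ _ _
  have h2 : ∑ i ∈ Finset.range (n + M), z i =
      ∑ i ∈ Finset.range n, z i + ∑ i ∈ Finset.range M, z (n + i) := Finset.sum_range_add _ _ _
  have h3 : ∑ i ∈ Finset.range n, (z (M + i) - z i) ≤
      ∑ _i ∈ Finset.range n, (z (M + n) - z 0) := by
    refine Finset.sum_le_sum fun i hi => ?_
    have := Finset.mem_range.1 hi
    have ha : z (M + i) ≤ z (M + n) := hz (by omega)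
    have hb : z 0 ≤ z i := hz (by omega)
    linarith
  rw [Finset.sum_const, Finset.card_range, nsmul_eq_mul, Finset.sum_sub_distrib] at h3
  rw [Finset.sum_sub_distrib]
  have h4 : ∑ i ∈ Finset.range M, z (i + n) = ∑ i ∈ Finset.range M, z (n + i) :=
    Finset.sum_congr rfl fun i _ => by rw [add_comm]
  rw [h4]
  rw [add_comm n M] at h2
  linarith

section Theta

variable {α : Type*} {p : ℕ} {T : α → α}
  {A : α → (EuclideanSpace ℝ (Fin p) ≃L[ℝ] EuclideanSpace ℝ (Fin p))}
  {Θ : Set (EuclideanSpace ℝ (Fin p))}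

lemma theta_iter (hΘinv : ∀ x, ∀ v ∈ Θ, ∃ t : ℝ, 0 < t ∧ t • (A x v) ∈ Θ) (n : ℕ) (x : α)
    {v : EuclideanSpace ℝ (Fin p)} (hv : v ∈ Θ) :
    ∃ t : ℝ, 0 < t ∧ ∃ v' ∈ Θ, cocycleIter T A n x v = t • v' := by
  induction n with
  | zero => exact ⟨1, one_pos, v, hv, by simp [cocycleIter_zero_apply]⟩
  | succ n ih =>
    obtain ⟨t, ht, v', hv', he⟩ := ih
    obtain ⟨s, hs, hs'⟩ := hΘinv (T^[n] x) v' hv'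
    refine ⟨t * s⁻¹, by positivity, _, hs', ?_⟩
    rw [cocycleIter_succ_apply', he, map_smul, smul_smul, mul_assoc, inv_mul_cancel₀ hs.ne',
      mul_one]

variable [MeasurableSpace α] {μ : Measure α} [IsProbabilityMeasure μ]

lemma theta_expand (hT : Ergodic T μ) (hA : ∀ w, Measurable fun x => A x w)
    (hΘcomp : IsCompact Θ) (hΘ0 : (0 : _) ∉ Θ)
    (hΘinv : ∀ x, ∀ v ∈ Θ, ∃ t : ℝ, 0 < t ∧ t • (A x v) ∈ Θ)
    (hΘexp : ∀ᵐ x ∂μ, ∀ v ∈ Θ, ∀ c : ℝ, c ≠ 0 →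
      ‖c • v‖ ≤ ‖A x (c • v)‖ ∧
        Tendsto (fun n : ℕ => ‖cocycleIter T A n x (c • v)‖) atTop atTop) :
    ∃ β > (0 : ℝ), ∀ᵐ x ∂μ, ∀ v ∈ Θ, ∀ C : ℝ,
      ¬ ∀ n : ℕ, ‖cocycleIter T A n x v‖ ≤ C * Real.exp (β * n) := by
  have hgood := ae_forall_iterate hT.toMeasurePreserving hΘexp
  have hmono : ∀ᵐ x ∂μ, ∀ v ∈ Θ, Monotone fun n => ‖cocycleIter T A n x v‖ := by
    filter_upwards [hgood] with x hx v hv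
    refine monotone_nat_of_le_succ fun n => ?_
    obtain ⟨t, ht, v', hv', he⟩ := theta_iter (T := T) hΘinv n x hv
    rw [cocycleIter_succ_apply', he]
    exact (hx n v' hv' t ht.ne').1
  let B : ℕ → Set α := fun n => {x | ∃ z : Θ, ‖cocycleIter T A n x z‖ - 2 * ‖(z : EuclideanSpace ℝ (Fin p))‖ ≤ 0}
  have : CompactSpace Θ := isCompact_iff_compactSpace.1 hΘcomp
  have hBm : ∀ n, MeasurableSet (B n) := by
    intro n
    apply measurableSet_exists_le
    · intro x
      fun_prop
    · intro z
      exact (cocycleIter_measurable hT.measurable hA n z).norm.sub_const _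
  have hcov : ∀ᵐ x ∂μ, ∃ n, x ∉ B n := by
    filter_upwards [hmono, hΘexp] with x hx hx2
    by_contra hcon
    push Not at hcon
    have hne := IsCompact.nonempty_iInter_of_sequence_nonempty_isCompact_isClosed
      (fun n : ℕ => {z : Θ | ‖cocycleIter T A n x z‖ - 2 * ‖(z : EuclideanSpace ℝ (Fin p))‖ ≤ 0})
      (fun n z hz => by
        have hz' : ‖cocycleIter T A (n + 1) x z‖ - 2 * ‖(z : EuclideanSpace ℝ (Fin p))‖ ≤ 0 := hz
        have h1 : ‖cocycleIter T A n x z‖ ≤ ‖cocycleIter T A (n + 1) x z‖ :=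
          hx z z.2 (Nat.le_succ n)
        show ‖cocycleIter T A n x z‖ - 2 * ‖(z : EuclideanSpace ℝ (Fin p))‖ ≤ 0
        linarith)
      (fun n => hcon n)
      (IsClosed.isCompact (isClosed_le (by fun_prop) continuous_const))
      (fun n => isClosed_le (by fun_prop) continuous_const)
    obtain ⟨z, hz⟩ := hne
    have hz' : ∀ n, ‖cocycleIter T A n x z‖ - 2 * ‖(z : EuclideanSpace ℝ (Fin p))‖ ≤ 0 :=
      fun n => Set.mem_iInter.1 hz n
    have ht := (hx2 z z.2 1 one_ne_zero).2
    obtain ⟨n, hn⟩ := (ht.eventually_gt_atTop (2 * ‖(z : EuclideanSpace ℝ (Fin p))‖)).exists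
    rw [one_smul] at hn
    linarith [hz' n]
  obtain ⟨n, hn⟩ : ∃ n, μ (B n)ᶜ ≠ 0 := by
    by_contra hcon
    push Not at hcon
    have h0 : ∀ᵐ x ∂μ, ∀ n, x ∈ B n := by
      refine ae_all_iff.2 fun n => ?_
      exact hcon n
    have hF : ∀ᵐ x ∂μ, False := by
      filter_upwards [hcov, h0] with x ⟨n, h1⟩ h2
      exact h1 (h2 n)
    have := hF.exists
    simp at this
  have hm : 0 < μ.real (B n)ᶜ :=
    ENNReal.toReal_pos hn (measure_ne_top _ _)
  set m := μ.real (B n)ᶜ with hmdef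
  have hbirk := birkhoff_upper hT (f := fun x => - (B n)ᶜ.indicator (fun _ => (1 : ℝ)) x)
    ((measurable_const.indicator (hBm n).compl).neg)
    (((integrable_const (1 : ℝ)).indicator (hBm n).compl).neg) (c := - (m / 2)) (by
      rw [integral_neg, integral_indicator_const _ (hBm n).compl, smul_eq_mul, mul_one]
      linarith)
  have hl2 : 0 < Real.log 2 := Real.log_pos (by norm_num)
  refine ⟨Real.log 2 * m / (4 * (n + 1)), by positivity, ?_⟩
  set β := Real.log 2 * m / (4 * ((n : ℝ) + 1)) with hβ
  have hβ' : n * β ≤ Real.log 2 * m / 4 := by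
    rw [hβ]
    rw [mul_div_assoc', div_le_div_iff₀ (by positivity) (by norm_num)]
    have : 0 ≤ Real.log 2 * m := by positivity
    nlinarith
  filter_upwards [hbirk, hmono] with x ⟨C, hC⟩ hx v hv C' hgrow
  have hv0 : v ≠ 0 := fun h => hΘ0 (h ▸ hv)
  have hpos : ∀ i, 0 < ‖cocycleIter T A i x v‖ := fun i =>
    norm_pos_iff.2 (by simpa using hv0)
  let z : ℕ → ℝ := fun i => Real.log ‖cocycleIter T A i x v‖
  have hz : Monotone z := fun i j hij => Real.log_le_log (hpos i) (hx v hv hij)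
  have hstep : ∀ i, Real.log 2 * (B n)ᶜ.indicator (fun _ => (1 : ℝ)) (T^[i] x) ≤
      z (i + n) - z i := by
    intro i
    by_cases hi : T^[i] x ∈ (B n)ᶜ
    · rw [Set.indicator_of_mem hi, mul_one]
      obtain ⟨t, ht, v', hv', he⟩ := theta_iter (T := T) hΘinv i x hv
      have h1 : 2 * ‖v'‖ ≤ ‖cocycleIter T A n (T^[i] x) v'‖ := by
        by_contra hlt
        exact hi ⟨⟨v', hv'⟩, by simp only; linarith⟩
      have h2 : 2 * ‖cocycleIter T A i x v‖ ≤ ‖cocycleIter T A (i + n) x v‖ := by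
        rw [cocycleIter_add_apply, he, map_smul, norm_smul, norm_smul]
        have := norm_nonneg t
        nlinarith
      have h3 := Real.log_le_log (by have := hpos i; positivity) h2
      rw [Real.log_mul (by norm_num) (hpos i).ne'] at h3
      show Real.log 2 ≤ Real.log _ - Real.log _
      linarith
    · rw [Set.indicator_of_notMem hi, mul_zero]
      have : z i ≤ z (i + n) := hz (by omega)
      linarith
  have hC'pos : 0 < C' := by
    have := (hpos 0).trans_le (hgrow 0)
    simpa using this
  have hzup : ∀ i, z i ≤ Real.log C' + β * i := by
    intro i
    have := Real.log_le_log (hpos i) (hgrow i)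
    rwa [Real.log_mul hC'pos.ne' (Real.exp_pos _).ne', Real.log_exp] at this
  have hfin : ∀ M : ℕ, Real.log 2 * m / 4 * M ≤
      Real.log 2 * C + n * (Real.log C' + β * n - z 0) := by
    intro M
    have h1 := hC M
    unfold birkhoffSum at h1
    rw [Finset.sum_neg_distrib] at h1
    have h2 : Real.log 2 * ∑ i ∈ Finset.range M,
        (B n)ᶜ.indicator (fun _ => (1 : ℝ)) (T^[i] x) ≤ n * (z (M + n) - z 0) := by
      rw [Finset.mul_sum]
      exact (Finset.sum_le_sum fun i _ => hstep i).trans (telescope_le hz n M)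
    have h3 := hzup (M + n)
    push_cast at h3
    have h4 : (n : ℝ) * z (M + n) ≤ n * (Real.log C' + β * (M + n)) := by gcongr
    have h5 : Real.log 2 * (m / 2 * M - C) ≤ Real.log 2 * ∑ i ∈ Finset.range M,
        (B n)ᶜ.indicator (fun _ => (1 : ℝ)) (T^[i] x) := by
      gcongr
      linarith
    have h6 : n * β * M ≤ Real.log 2 * m / 4 * M := by gcongr
    nlinarith
  obtain ⟨M, hM⟩ := exists_nat_gt
    ((Real.log 2 * C + n * (Real.log C' + β * n - z 0)) / (Real.log 2 * m / 4))
  rw [div_lt_iff₀ (by positivity)] at hM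
  linarith [hfin M]

end Theta

section Final

lemma mem_centralStable {α : Type*} {p : ℕ} {T : α → α}
    {A : α → (EuclideanSpace ℝ (Fin p) ≃L[ℝ] EuclideanSpace ℝ (Fin p))} {x : α}
    {w : EuclideanSpace ℝ (Fin p)}
    (h : ∀ s > 0, ∃ C : ℝ, ∀ n : ℕ, ‖cocycleIter T A n x w‖ ≤ C * Real.exp (s * n)) :
    w ∈ centralStable T A x := by
  show limsup (fun n : ℕ => ‖cocycleIter T A n x w‖ ^ ((1 : ℝ) / n)) atTop ≤ 1
  refine le_of_forall_gt_imp_ge_of_dense fun b hb => ?_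
  refine limsup_le_of_le
    (isCoboundedUnder_le_of_le atTop (x := 0) fun n => Real.rpow_nonneg (norm_nonneg _) _) ?_
  have hb0 : 0 < b := by linarith
  have hlb : 0 < Real.log b := Real.log_pos hb
  obtain ⟨C, hC⟩ := h (Real.log b / 2) (by positivity)
  have hlim : Tendsto (fun n : ℕ => Real.exp (Real.log b / 2 * n)) atTop atTop :=
    Real.tendsto_exp_atTop.comp
      (tendsto_natCast_atTop_atTop.const_mul_atTop (by positivity))
  filter_upwards [hlim.eventually_ge_atTop C, eventually_gt_atTop 0] with n hn hn0
  have h1 : ‖cocycleIter T A n x w‖ ≤ b ^ (n : ℝ) := by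
    refine (hC n).trans ?_
    rw [Real.rpow_def_of_pos hb0]
    calc C * Real.exp (Real.log b / 2 * n)
        ≤ Real.exp (Real.log b / 2 * n) * Real.exp (Real.log b / 2 * n) := by gcongr
      _ = _ := by rw [← Real.exp_add]; ring_nf
  have hn' : (n : ℝ) ≠ 0 := by exact_mod_cast hn0.ne'
  calc ‖cocycleIter T A n x w‖ ^ ((1 : ℝ) / n) ≤ (b ^ (n : ℝ)) ^ ((1 : ℝ) / n) :=
        Real.rpow_le_rpow (norm_nonneg _) h1 (by positivity)
    _ = b := by
      rw [← Real.rpow_mul hb0.le, mul_one_div_cancel hn', Real.rpow_one]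

lemma line_lower_bound {F : Type*} [NormedAddCommGroup F] [NormedSpace ℝ F] {a b : ℕ → F}
    {a0 b0 : F} (ha : Tendsto a atTop (nhds a0)) (hb : Tendsto b atTop (nhds b0))
    (hb0 : b0 ≠ 0) (h : ∀ t : ℝ, a0 + t • b0 ≠ 0) :
    ∃ κ > (0 : ℝ), ∀ᶠ l in atTop, ∀ t : ℝ, κ ≤ ‖a l + t • b l‖ := by
  have hbp : 0 < ‖b0‖ := norm_pos_iff.2 hb0
  set R := 2 * (‖a0‖ + 2) / ‖b0‖ with hR
  have hRpos : 0 < R := by positivity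
  obtain ⟨t0, -, ht0⟩ := (isCompact_Icc (a := -R) (b := R)).exists_isMinOn
    ⟨0, by constructor <;> linarith⟩ (f := fun t : ℝ => ‖a0 + t • b0‖)
    (by fun_prop : Continuous fun t : ℝ => ‖a0 + t • b0‖).continuousOn
  set κ := ‖a0 + t0 • b0‖ with hκ
  have hκpos : 0 < κ := norm_pos_iff.2 (h t0)
  refine ⟨min 1 (κ / 2), by positivity, ?_⟩
  have e1 : ∀ᶠ l in atTop, ‖a l - a0‖ < min 1 (κ / 4) := by
    have := Metric.tendsto_nhds.1 ha (min 1 (κ / 4)) (by positivity)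
    simpa [dist_eq_norm] using this
  have e2 : ∀ᶠ l in atTop, ‖b l - b0‖ < min (‖b0‖ / 2) (κ / (4 * R)) := by
    have := Metric.tendsto_nhds.1 hb (min (‖b0‖ / 2) (κ / (4 * R))) (by positivity)
    simpa only [dist_eq_norm] using this
  filter_upwards [e1, e2] with l h1 h2 t
  have h11 := h1.trans_le (min_le_left _ _)
  have h12 := h1.trans_le (min_le_right _ _)
  have h21 := h2.trans_le (min_le_left _ _)
  have h22 := h2.trans_le (min_le_right _ _)
  by_cases ht : |t| ≤ R
  · refine (min_le_right _ _).trans ?_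
    have hk : κ ≤ ‖a0 + t • b0‖ := ht0 (abs_le.1 ht)
    have hd : a0 + t • b0 = (a l + t • b l) - (a l - a0) - t • (b l - b0) := by
      rw [smul_sub]; abel
    have hn : ‖a0 + t • b0‖ ≤ ‖a l + t • b l‖ + ‖a l - a0‖ + |t| * ‖b l - b0‖ := by
      rw [hd]
      refine (norm_sub_le _ _).trans ?_
      rw [norm_smul, Real.norm_eq_abs]
      gcongr
      exact norm_sub_le _ _
    have h3 : |t| * ‖b l - b0‖ ≤ R * (κ / (4 * R)) := by gcongr
    have h4 : R * (κ / (4 * R)) = κ / 4 := by field_simp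
    linarith
  · refine (min_le_left _ _).trans ?_
    push Not at ht
    have h3 : ‖t • b l‖ ≤ ‖a l + t • b l‖ + ‖a l‖ := by
      have := norm_sub_le (a l + t • b l) (a l)
      simpa using this
    have h4 : ‖a l‖ ≤ ‖a0‖ + 1 := by
      have := norm_add_le (a l - a0) a0
      rw [sub_add_cancel] at this
      linarith
    have h5 : ‖b0‖ / 2 ≤ ‖b l‖ := by
      have := norm_sub_le (b l) (b l - b0)
      rw [sub_sub_cancel] at this
      linarith
    rw [norm_smul, Real.norm_eq_abs] at h3
    have h6 : R * (‖b0‖ / 2) ≤ |t| * ‖b l‖ := by gcongr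
    have h7 : R * (‖b0‖ / 2) = ‖a0‖ + 2 := by rw [hR]; field_simp
    linarith

lemma not_mem_lineDir {p : ℕ} {v u : EuclideanSpace ℝ (Fin p)} (hu : ‖u‖ = 1)
    (huv : inner ℝ u v = 0) : (0 : _) ∉ lineDir v u := by
  rintro ⟨t, ht⟩
  have h1 : inner ℝ u (u + t • v) = 0 := by rw [← ht, inner_zero_right]
  rw [inner_add_right, inner_smul_right, huv, real_inner_self_eq_norm_sq, hu] at h1
  norm_num at h1

/-- The set of `x` for which some point of the line is mapped close to the origin. -/
def badSet {α : Type*} {p : ℕ} (T : α → α)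
    (A : α → (EuclideanSpace ℝ (Fin p) ≃L[ℝ] EuclideanSpace ℝ (Fin p))) (n : ℕ)
    (v u : EuclideanSpace ℝ (Fin p)) (K : ℝ) : Set α :=
  {x | ∃ t : ℝ, ‖cocycleIter T A n x (u + t • v)‖ < K}

lemma measurableSet_badSet {α : Type*} [MeasurableSpace α] {p : ℕ} {T : α → α}
    {A : α → (EuclideanSpace ℝ (Fin p) ≃L[ℝ] EuclideanSpace ℝ (Fin p))} (hT : Measurable T)
    (hA : ∀ w, Measurable fun x => A x w) (n : ℕ)
    (v u : EuclideanSpace ℝ (Fin p)) (K : ℝ) : MeasurableSet (badSet T A n v u K) := by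
  have : badSet T A n v u K =
      ⋃ t : ℚ, {x | ‖cocycleIter T A n x (u + (t : ℝ) • v)‖ < K} := by
    ext x
    simp only [badSet, Set.mem_ofPred_eq, Set.mem_iUnion]
    constructor
    · rintro ⟨t, ht⟩
      have hop : IsOpen {t : ℝ | ‖cocycleIter T A n x (u + t • v)‖ < K} :=
        isOpen_lt (by fun_prop) continuous_const
      obtain ⟨s, hs⟩ := Rat.denseRange_cast (𝕜 := ℝ) |>.exists_mem_open hop ⟨t, ht⟩
      exact ⟨s, hs⟩
    · rintro ⟨t, ht⟩
      exact ⟨t, ht⟩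
  rw [this]
  exact MeasurableSet.iUnion fun t =>
    measurableSet_lt (cocycleIter_measurable hT hA n _).norm measurable_const

/-- Normalisation of lines. -/
lemma normalise_line {α : Type*} {p : ℕ} (T : α → α)
    (A : α → (EuclideanSpace ℝ (Fin p) ≃L[ℝ] EuclideanSpace ℝ (Fin p)))
    {v u : EuclideanSpace ℝ (Fin p)} (hv : v ≠ 0) (h : (0 : _) ∉ lineDir v u) :
    ∃ u0 : EuclideanSpace ℝ (Fin p), ‖u0‖ = 1 ∧ inner ℝ u0 v = 0 ∧ ∀ (n : ℕ) (c : ℝ),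
      {x | Real.log
        (infDist 0 ((cocycleIter T A n x) '' lineDir v u) / infDist 0 (lineDir v u)) < c} ⊆
      badSet T A n v u0 (Real.exp c) := by
  have hvp : 0 < ‖v‖ := norm_pos_iff.2 hv
  set s : ℝ := inner ℝ u v / ‖v‖ ^ 2 with hs
  set u' := u - s • v with hu'
  have horth : inner ℝ u' v = 0 := by
    rw [hu', inner_sub_left, inner_smul_left, real_inner_self_eq_norm_sq, hs]
    simp
    field_simp
    ring
  have hu'0 : u' ≠ 0 := by
    intro h0
    exact h ⟨-s, by rw [neg_smul, ← sub_eq_add_neg, ← hu', h0]⟩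
  set ρ := ‖u'‖ with hρ
  have hρpos : 0 < ρ := norm_pos_iff.2 hu'0
  have hdist : infDist 0 (lineDir v u) ≤ ρ := by
    have hm : u' ∈ lineDir v u := ⟨-s, by rw [neg_smul, ← sub_eq_add_neg]⟩
    have := infDist_le_dist_of_mem (x := (0 : EuclideanSpace ℝ (Fin p))) hm
    simpa using this
  have hdist0 : 0 < infDist 0 (lineDir v u) := by
    have hne : (lineDir v u).Nonempty := ⟨u, 0, by simp⟩
    refine lt_of_lt_of_le hρpos ((le_infDist hne).2 ?_)
    rintro w ⟨t, rfl⟩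
    rw [dist_zero_left]
    have e : u + t • v = u' + (t + s) • v := by rw [hu', add_smul]; abel
    have h1 : ‖u + t • v‖ * ‖u + t • v‖ = ρ * ρ + ‖(t + s) • v‖ * ‖(t + s) • v‖ := by
      rw [e]
      exact norm_add_sq_eq_norm_sq_add_norm_sq_of_inner_eq_zero _ _
        (by rw [inner_smul_right, horth, mul_zero])
    nlinarith [norm_nonneg (u + t • v), mul_self_nonneg ‖(t + s) • v‖]
  refine ⟨ρ⁻¹ • u', ?_, ?_, ?_⟩
  · rw [norm_smul, norm_inv, Real.norm_of_nonneg hρpos.le, ← hρ, inv_mul_cancel₀ hρpos.ne']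
  · rw [inner_smul_left, horth, mul_zero]
  · intro n c x hx
    by_contra hcon
    have hall : ∀ t : ℝ, Real.exp c ≤ ‖cocycleIter T A n x (ρ⁻¹ • u' + t • v)‖ := by
      intro t
      by_contra hlt
      exact hcon ⟨t, not_le.1 hlt⟩
    have h1 : Real.exp c * ρ ≤ infDist 0 ((cocycleIter T A n x) '' lineDir v u) := by
      have hne : ((cocycleIter T A n x) '' lineDir v u).Nonempty :=
        Set.Nonempty.image _ ⟨u, 0, by simp⟩
      refine (le_infDist hne).2 ?_
      rintro _ ⟨w, ⟨t, rfl⟩, rfl⟩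
      rw [dist_zero_left]
      have e : u + t • v = ρ • (ρ⁻¹ • u' + (ρ⁻¹ * (t + s)) • v) := by
        rw [smul_add, smul_smul, smul_smul, ← mul_assoc, mul_inv_cancel₀ hρpos.ne', one_smul,
          one_mul, hu', add_smul]
        abel
      rw [e, map_smul, norm_smul, Real.norm_of_nonneg hρpos.le, mul_comm]
      exact mul_le_mul_of_nonneg_left (hall _) hρpos.le
    have h2 : Real.exp c ≤
        infDist 0 ((cocycleIter T A n x) '' lineDir v u) / infDist 0 (lineDir v u) := by
      rw [le_div_iff₀ hdist0]
      refine le_trans ?_ h1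
      gcongr
    have h3 := Real.log_le_log (Real.exp_pos c) h2
    rw [Real.log_exp] at h3
    have hx' : Real.log (infDist 0 ((cocycleIter T A n x) '' lineDir v u) /
      infDist 0 (lineDir v u)) < c := hx
    linarith

end Final

/-- Lemma on uniform expansion of lines: for a measurable cocycle `(T,A)` with adapted compact
set `Θ` such that every line `J ∈ J(Θ)` avoids `E^{cs}(x)` for a.e. `x`, there is `ε₀ > 0`
with `μ {x : log (‖A_n(x)·J‖/‖J‖) < ε₀ n} → 0` as `n → ∞`, uniformly over `J ∈ J(Θ)`;
here `‖J‖` is the euclidean distance from the line `J` to the origin. -/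
theorem lines_uniform_expansion
    {α : Type*} [MeasurableSpace α] {p : ℕ}
    (μ : Measure α) [IsProbabilityMeasure μ]
    (T : α → α) (hT : Ergodic T μ)
    (A : α → (EuclideanSpace ℝ (Fin p) ≃L[ℝ] EuclideanSpace ℝ (Fin p)))
    (hAmeas : ∀ w : EuclideanSpace ℝ (Fin p), Measurable fun x => A x w)
    (hint : Integrable (fun x =>
      Real.log ‖(A x : EuclideanSpace ℝ (Fin p) →L[ℝ] EuclideanSpace ℝ (Fin p))‖) μ)
    (Θ : Set (EuclideanSpace ℝ (Fin p))) (hΘcomp : IsCompact Θ) (hΘ0 : (0 : _) ∉ Θ)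
    -- Θ is adapted: projectively invariant, and the cocycle does not contract and eventually
    -- expands to infinity every vector whose direction lies in Θ
    (hΘinv : ∀ x, ∀ v ∈ Θ, ∃ t : ℝ, 0 < t ∧ t • (A x v) ∈ Θ)
    (hΘexp : ∀ᵐ x ∂μ, ∀ v ∈ Θ, ∀ c : ℝ, c ≠ 0 →
      ‖c • v‖ ≤ ‖A x (c • v)‖ ∧
        Tendsto (fun n : ℕ => ‖cocycleIter T A n x (c • v)‖) atTop atTop)
    -- every line parallel to a direction in Θ and not through 0 avoids E^{cs}(x) a.e.
    (hcs : ∀ v ∈ Θ, ∀ u : EuclideanSpace ℝ (Fin p), (0 : _) ∉ lineDir v u →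
      ∀ᵐ x ∂μ, lineDir v u ∩ centralStable T A x = ∅) :
    ∃ ε₀ > (0 : ℝ), ∀ δ > (0 : ℝ), ∃ N : ℕ, ∀ n ≥ N,
      ∀ v ∈ Θ, ∀ u : EuclideanSpace ℝ (Fin p), (0 : _) ∉ lineDir v u →
        μ {x | Real.log
              (infDist 0 ((cocycleIter T A n x) '' lineDir v u) / infDist 0 (lineDir v u)) <
            ε₀ * n} ≤ ENNReal.ofReal δ := by
  obtain ⟨k, r, hr, hsep⟩ := separation hT hAmeas hint
  obtain ⟨β, hβ, hexp⟩ := theta_expand hT hAmeas hΘcomp hΘ0 hΘinv hΘexp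
  refine ⟨r / 2, by positivity, fun δ hδ => ?_⟩
  suffices hsuff : ∃ N : ℕ, ∀ n ≥ N, ∀ v ∈ Θ, ∀ u : EuclideanSpace ℝ (Fin p), ‖u‖ = 1 →
      inner ℝ u v = 0 → μ (badSet T A n v u (Real.exp (r / 2 * n))) ≤ ENNReal.ofReal δ by
    obtain ⟨N, hN⟩ := hsuff
    refine ⟨N, fun n hn v hv u hu => ?_⟩
    obtain ⟨u0, h1, h2, h3⟩ := normalise_line T A (fun h => hΘ0 (h ▸ hv)) hu
    exact (measure_mono (h3 n _)).trans (hN n hn v hv u0 h1 h2)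
  by_contra hcon
  push Not at hcon
  choose n hn v hv u hu huv hμ using hcon
  have hcomp : IsCompact ((Metric.sphere (0 : EuclideanSpace ℝ (Fin p)) 1 ×ˢ Θ) ∩
      {z : EuclideanSpace ℝ (Fin p) × EuclideanSpace ℝ (Fin p) | inner ℝ z.1 z.2 = 0}) :=
    ((isCompact_sphere 0 1).prod hΘcomp).inter_right
      (isClosed_eq (by fun_prop) continuous_const)
  obtain ⟨⟨u0, v0⟩, ⟨⟨hu0, hv0⟩, huv0⟩, φ, hφ, hlim⟩ := hcomp.tendsto_subseq
    (x := fun l => (u l, v l)) (fun l => ⟨⟨by simpa using hu l, hv l⟩, huv l⟩)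
  have hu0' : ‖u0‖ = 1 := by simpa using hu0
  have hlu : Tendsto (fun l => u (φ l)) atTop (nhds u0) :=
    (continuous_fst.tendsto _).comp hlim
  have hlv : Tendsto (fun l => v (φ l)) atTop (nhds v0) :=
    (continuous_snd.tendsto _).comp hlim
  have hln : Tendsto (fun l => n (φ l)) atTop atTop :=
    tendsto_atTop_mono (fun l => hn (φ l)) hφ.tendsto_atTop
  have hkey : ∀ᵐ x ∂μ, ∀ᶠ l in atTop,
      (x ∈ badSet T A (n (φ l)) (v (φ l)) (u (φ l)) (Real.exp (r / 2 * n (φ l))) ↔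
        x ∈ (∅ : Set α)) := by
    filter_upwards [hsep, hexp, hcs v0 hv0 u0 (not_mem_lineDir hu0' huv0)]
      with x ⟨q, hq1, hq2⟩ hx2 hx3
    have hqv : q v0 ≠ 0 := by
      intro h0
      obtain ⟨C, hC⟩ := hq2 v0 h0 β hβ
      exact hx2 v0 hv0 C hC
    have hqu : ∀ t : ℝ, q u0 + t • q v0 ≠ 0 := by
      intro t h0
      have h1 : q (u0 + t • v0) = 0 := by rw [map_add, map_smul, h0]
      have h2 : u0 + t • v0 ∈ lineDir v0 u0 ∩ centralStable T A x :=
        ⟨⟨t, rfl⟩, mem_centralStable (hq2 _ h1)⟩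
      rw [hx3] at h2
      exact h2
    obtain ⟨κ, hκ, hev⟩ := line_lower_bound ((q.continuous.tendsto u0).comp hlu)
      ((q.continuous.tendsto v0).comp hlv) hqv hqu
    have hlim2 : Tendsto (fun l => Real.exp (r / 2 * n (φ l))) atTop atTop :=
      Real.tendsto_exp_atTop.comp
        ((tendsto_natCast_atTop_atTop.comp hln).const_mul_atTop (by positivity))
    filter_upwards [hev, hlim2.eventually_ge_atTop κ⁻¹] with l hl1 hl2
    simp only [Set.mem_empty_iff_false, iff_false]
    rintro ⟨t, ht⟩
    have h1 := hq1 (n (φ l)) (u (φ l) + t • v (φ l))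
    have h2 : κ ≤ ‖q (u (φ l) + t • v (φ l))‖ := by
      rw [map_add, map_smul]
      exact hl1 t
    have h3 : 1 ≤ Real.exp (r / 2 * n (φ l)) * κ := by
      have := mul_le_mul_of_nonneg_right hl2 hκ.le
      rwa [inv_mul_cancel₀ hκ.ne'] at this
    have h4 : Real.exp (r * n (φ l)) =
        Real.exp (r / 2 * n (φ l)) * Real.exp (r / 2 * n (φ l)) := by
      rw [← Real.exp_add]; ring_nf
    have h5 : Real.exp (r * n (φ l)) * κ ≤
        Real.exp (r * n (φ l)) * ‖q (u (φ l) + t • v (φ l))‖ := by gcongr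
    have h6 := Real.exp_pos (r / 2 * n (φ l))
    rw [h4] at h5
    rw [h4] at h1
    nlinarith
  have htend := tendsto_measure_of_ae_tendsto_indicator_of_isFiniteMeasure (μ := μ) atTop
    MeasurableSet.empty
    (fun l => measurableSet_badSet hT.measurable hAmeas (n (φ l)) (v (φ l)) (u (φ l))
      (Real.exp (r / 2 * n (φ l)))) hkey
  rw [measure_empty] at htend
  obtain ⟨l, hl⟩ := (htend.eventually_lt_const (ENNReal.ofReal_pos.2 hδ)).exists
  exact absurd hl (not_lt.2 (hμ (φ l)).le)
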